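/- arXiv:1610.07992 — 8 statements merged into one kernel-verified Lean document; each statement's English description precedes it below -/
import Mathlib

section
/- Let F : S^d → ℝ be continuously differentiable, nondecreasing with respect to the Loewner order (M ≤ N implies F(M) ≤ F(N)), and with uniformly bounded gradient (there is L such that the Frobenius norm of the gradient ∇F(M) is at most L for all M). Then for every M ∈ S^d one has the Isaacs-type representation F(M) = inf_{β ∈ S^d} sup_{α ∈ S^d} [ (∫₀¹ ∇F((1−t)β + tα) dt) : (M − β) + F(β) ], where ∇F is the gradient of F with respect to the Frobenius inner product and the integral is the (Bochner/componentwise) integral over t ∈ [0,1]. -/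
open scoped BigOperators

noncomputable section

/-- Frobenius inner product of two real `d × d` matrices: `A : B = ∑ᵢⱼ Aᵢⱼ Bᵢⱼ`. -/
def frob {d : ℕ} (A B : Matrix (Fin d) (Fin d) ℝ) : ℝ := ∑ i, ∑ j, A i j * B i j

/-- Frobenius norm `|A| = √(A : A)`. -/
def frobNorm {d : ℕ} (A : Matrix (Fin d) (Fin d) ℝ) : ℝ := Real.sqrt (frob A A)

/-- Each entry of a matrix is bounded by its Frobenius norm. -/
theorem abs_apply_le_frobNorm {d : ℕ} (A : Matrix (Fin d) (Fin d) ℝ) (i j : Fin d) :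
    |A i j| ≤ frobNorm A := by
  refine Real.abs_le_sqrt ?_
  have hnonneg : ∀ k l, 0 ≤ A k l * A k l := fun k l => mul_self_nonneg _
  calc A i j ^ 2 = A i j * A i j := sq _
    _ ≤ ∑ l, A i l * A i l :=
      Finset.single_le_sum (f := fun l => A i l * A i l) (fun l _ => hnonneg i l)
        (Finset.mem_univ j)
    _ ≤ frob A A :=
      Finset.single_le_sum (f := fun k => ∑ l, A k l * A k l)
        (fun k _ => Finset.sum_nonneg fun l _ => hnonneg k l) (Finset.mem_univ i)

/-- The Frobenius product with an entrywise integral is the integral of the Frobenius products. -/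
theorem frob_of_integral {d : ℕ} {H : ℝ → Matrix (Fin d) (Fin d) ℝ} (hH : Continuous H)
    (N : Matrix (Fin d) (Fin d) ℝ) (a b : ℝ) :
    frob (Matrix.of fun i j => ∫ t in a..b, H t i j) N = ∫ t in a..b, frob (H t) N := by
  have hint : ∀ i j, IntervalIntegrable (fun t => H t i j * N i j) MeasureTheory.volume a b :=
    fun i j => ((hH.matrix_elem i j).mul continuous_const).intervalIntegrable a b
  simp only [frob, Matrix.of_apply]
  rw [intervalIntegral.integral_finsetSum fun i _ => by
    simpa only [Finset.sum_fn] using IntervalIntegrable.sum Finset.univ fun j _ => hint i j]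
  refine Finset.sum_congr rfl fun i _ => ?_
  rw [intervalIntegral.integral_finsetSum fun j _ => hint i j]
  simp only [intervalIntegral.integral_mul_const]

/-- If the entries of `H` are bounded by `L`, the Frobenius product of `N` with the entrywise
integral of `H` over `[0, 1]` is at most `L` times the sum of the absolute entries of `N`. -/
theorem frob_of_integral_le {d : ℕ} {H : ℝ → Matrix (Fin d) (Fin d) ℝ} {L : ℝ}
    (hH : ∀ t i j, |H t i j| ≤ L) (N : Matrix (Fin d) (Fin d) ℝ) :
    frob (Matrix.of fun i j => ∫ t in (0:ℝ)..1, H t i j) N ≤ ∑ i, ∑ j, L * |N i j| := by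
  refine Finset.sum_le_sum fun i _ => Finset.sum_le_sum fun j _ => ?_
  have hle : |∫ t in (0:ℝ)..1, H t i j| ≤ L := by
    simpa using intervalIntegral.norm_integral_le_of_norm_le_const (a := 0) (b := 1)
      (f := fun t => H t i j) (C := L) fun t _ => hH t i j
  calc _ ≤ |(∫ t in (0:ℝ)..1, H t i j) * N i j| := le_abs_self _
    _ = |∫ t in (0:ℝ)..1, H t i j| * |N i j| := abs_mul _ _
    _ ≤ L * |N i j| := by gcongr

/-- **Isaacs-type representation of elliptic operators.**
Let `F : S^d → ℝ` be continuously differentiable (with gradient `G` with respect to the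
Frobenius inner product), nondecreasing with respect to the Loewner order, and with uniformly
bounded gradient.  Then for every symmetric `M`,
`F(M) = inf_β sup_α [ (∫₀¹ ∇F((1-t)β + tα) dt) : (M - β) + F(β) ]`,
the infimum and supremum being taken over all symmetric matrices. -/
theorem isaacs_representation (d : ℕ)
    (F : Matrix (Fin d) (Fin d) ℝ → ℝ)
    (G : Matrix (Fin d) (Fin d) ℝ → Matrix (Fin d) (Fin d) ℝ)
    -- the gradient of a function on `S^d` takes values in `S^d`:
    (hGsymm : ∀ A : Matrix (Fin d) (Fin d) ℝ, A.IsSymm → (G A).IsSymm)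
    -- `F` is differentiable on symmetric matrices with gradient `G` (w.r.t. the
    -- Frobenius inner product), i.e. along every line through symmetric matrices
    -- in a symmetric direction the derivative is `∇F : N`:
    (hderiv : ∀ A N : Matrix (Fin d) (Fin d) ℝ, A.IsSymm → N.IsSymm → ∀ t₀ : ℝ,
      HasDerivAt (fun t : ℝ => F (A + t • N)) (frob (G (A + t₀ • N)) N) t₀)
    -- the gradient is continuous (on symmetric matrices):
    (hGcont : ContinuousOn G {A : Matrix (Fin d) (Fin d) ℝ | A.IsSymm})
    -- `F` is nondecreasing with respect to the Loewner order:
    (hmono : ∀ M N : Matrix (Fin d) (Fin d) ℝ, M.IsSymm → N.IsSymm →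
      (N - M).PosSemidef → F M ≤ F N)
    -- the gradient is uniformly bounded in the Frobenius norm:
    (L : ℝ)
    (hbdd : ∀ A : Matrix (Fin d) (Fin d) ℝ, A.IsSymm → frobNorm (G A) ≤ L)
    (M : Matrix (Fin d) (Fin d) ℝ) (hM : M.IsSymm) :
    F M = ⨅ β : {A : Matrix (Fin d) (Fin d) ℝ // A.IsSymm},
            ⨆ α : {A : Matrix (Fin d) (Fin d) ℝ // A.IsSymm},
              (frob
                (Matrix.of fun i j => ∫ t in (0:ℝ)..1,
                  G ((1 - t) • (β : Matrix (Fin d) (Fin d) ℝ)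
                      + t • (α : Matrix (Fin d) (Fin d) ℝ)) i j)
                (M - (β : Matrix (Fin d) (Fin d) ℝ))
               + F (β : Matrix (Fin d) (Fin d) ℝ)) := by
  have hseg : ∀ (A B : Matrix (Fin d) (Fin d) ℝ), A.IsSymm → B.IsSymm → ∀ t : ℝ,
      ((1 - t) • A + t • B).IsSymm :=
    fun A B hA hB t => (hA.smul _).add (hB.smul _)
  have hbound : ∀ β α : {A : Matrix (Fin d) (Fin d) ℝ // A.IsSymm}, ∀ (t : ℝ) (i j : Fin d),
      |G ((1 - t) • β.1 + t • α.1) i j| ≤ L := fun β α t i j =>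
    (abs_apply_le_frobNorm _ i j).trans (hbdd _ (hseg _ _ β.2 α.2 t))
  have hftc : ∀ β : Matrix (Fin d) (Fin d) ℝ, β.IsSymm →
      frob (Matrix.of fun i j => ∫ t in (0:ℝ)..1, G ((1 - t) • β + t • M) i j) (M - β) + F β
        = F M := by
    intro β hβ
    have hpath : ∀ t : ℝ, β + t • (M - β) = (1 - t) • β + t • M := fun t => by module
    have hcont : Continuous fun t : ℝ => G ((1 - t) • β + t • M) :=
      hGcont.comp_continuous (by fun_prop) (hseg β M hβ hM)
    have hfrob : Continuous fun t : ℝ => frob (G ((1 - t) • β + t • M)) (M - β) :=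
      continuous_finsetSum _ fun i _ => continuous_finsetSum _ fun j _ =>
        (hcont.matrix_elem i j).mul continuous_const
    have hd := hderiv β (M - β) hβ (hM.sub hβ)
    simp only [hpath] at hd
    rw [frob_of_integral hcont, intervalIntegral.integral_eq_sub_of_hasDerivAt
      (fun t _ => hd t) (hfrob.intervalIntegrable 0 1)]
    simp
  have hle : ∀ β : {A : Matrix (Fin d) (Fin d) ℝ // A.IsSymm},
      F M ≤ ⨆ α : {A : Matrix (Fin d) (Fin d) ℝ // A.IsSymm},
        (frob (Matrix.of fun i j => ∫ t in (0:ℝ)..1, G ((1 - t) • β.1 + t • α.1) i j)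
          (M - β.1) + F β.1) := by
    intro β
    refine (hftc β.1 β.2).ge.trans (le_ciSup (f := fun α : {A : Matrix (Fin d) (Fin d) ℝ //
      A.IsSymm} => frob (Matrix.of fun i j => ∫ t in (0:ℝ)..1,
        G ((1 - t) • β.1 + t • α.1) i j) (M - β.1) + F β.1) ?_ ⟨M, hM⟩)
    refine ⟨(∑ i, ∑ j, L * |(M - β.1) i j|) + F β.1, ?_⟩
    rintro _ ⟨α, rfl⟩
    exact add_le_add_left (frob_of_integral_le (hbound β α) _) _
  have : Nonempty {A : Matrix (Fin d) (Fin d) ℝ // A.IsSymm} := ⟨⟨M, hM⟩⟩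
  refine le_antisymm (le_ciInf hle) ?_
  refine (ciInf_le ⟨F M, Set.forall_mem_range.2 hle⟩ ⟨M, hM⟩).trans_eq ?_
  simp [frob]
end
end

section
/- Pucci's nonuniqueness example: let d ≥ 3, let λ be a real number with max{2 − d/2, 0} < λ < 1, set b := (d − 2 + λ)/(1 − λ), and for x ∈ ℝ^d with x ≠ 0 define A(x) := I + b (x xᵀ)/|x|² and u(x) := |x|^λ − 1. Then for every x ≠ 0: (i) A(x) is symmetric with |ξ|² ≤ ξ · A(x) ξ ≤ (1+b)|ξ|² for all ξ ∈ ℝ^d; (ii) u is twice differentiable at x with Hessian D²u(x) = λ(λ−2)|x|^{λ−4} x xᵀ + λ|x|^{λ−2} I; and (iii) A(x) : D²u(x) = 0, i.e. u solves the nondivergence-form equation A : D²u = 0 pointwise on ℝ^d∖{0}. -/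
open scoped BigOperators

noncomputable section

section NormRpow

variable {E : Type*} [NormedAddCommGroup E] [InnerProductSpace ℝ E]

/-- Away from the origin, the derivative of `‖x‖ ^ p` is `p * ‖x‖ ^ (p - 2) * ⟪x, ·⟫`. -/
theorem hasFDerivAt_norm_rpow_of_ne_zero (p : ℝ) {x : E} (hx : x ≠ 0) :
    HasFDerivAt (fun y : E => ‖y‖ ^ p) ((p * ‖x‖ ^ (p - 2)) • innerSL ℝ x) x := by
  have hsq : ∀ (q : ℝ) (y : E), ‖y‖ ^ q = (‖y‖ ^ 2) ^ (q / 2) := fun q y => by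
    rw [← Real.rpow_natCast, ← Real.rpow_mul (norm_nonneg y)]
    congr 1
    push_cast
    ring
  have h := (hasStrictFDerivAt_norm_sq x).hasFDerivAt.rpow_const (p := p / 2)
    (Or.inl (pow_ne_zero 2 (norm_ne_zero_iff.2 hx)))
  rw [funext (hsq p), hsq (p - 2), show (p - 2) / 2 = p / 2 - 1 by ring]
  refine h.congr_fderiv ?_
  ext v
  simp
  ring

theorem contDiffAt_norm_rpow_of_ne_zero (p : ℝ) {x : E} (hx : x ≠ 0) {n : WithTop ℕ∞} :
    ContDiffAt ℝ n (fun y : E => ‖y‖ ^ p) x :=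
  (contDiffAt_norm ℝ hx).rpow_const_of_ne (norm_ne_zero_iff.2 hx)

end NormRpow

/-- The Hessian of a function that agrees with `‖y‖ ^ p - 1` away from the origin. -/
theorem hessian_norm_rpow_sub_one {d : ℕ} (p : ℝ) {u : EuclideanSpace ℝ (Fin d) → ℝ}
    (hu : ∀ x : EuclideanSpace ℝ (Fin d), x ≠ 0 → u x = ‖x‖ ^ p - 1)
    {x : EuclideanSpace ℝ (Fin d)} (hx : x ≠ 0) (i j : Fin d) :
    fderiv ℝ (fun y => fderiv ℝ u y (EuclideanSpace.single j (1:ℝ))) x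
        (EuclideanSpace.single i (1:ℝ)) =
      p * (p - 2) * ‖x‖ ^ (p - 4) * (x i * x j) +
        p * ‖x‖ ^ (p - 2) * (1 : Matrix (Fin d) (Fin d) ℝ) i j := by
  have hgrad : ∀ y : EuclideanSpace ℝ (Fin d), y ≠ 0 →
      fderiv ℝ u y (EuclideanSpace.single j (1:ℝ)) = p * ‖y‖ ^ (p - 2) * y j := by
    intro y hy
    have hev : u =ᶠ[nhds y] fun z => ‖z‖ ^ p - 1 := by
      filter_upwards [isOpen_ne.mem_nhds hy] with z hz using hu z hz
    rw [hev.fderiv_eq, ((hasFDerivAt_norm_rpow_of_ne_zero p hy).sub_const 1).fderiv]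
    simp [EuclideanSpace.inner_single_right]
  have hev : (fun y => fderiv ℝ u y (EuclideanSpace.single j (1:ℝ))) =ᶠ[nhds x]
      fun y => p * ‖y‖ ^ (p - 2) * y j := by
    filter_upwards [isOpen_ne.mem_nhds hx] with z hz using hgrad z hz
  have hcoord : HasFDerivAt (fun y : EuclideanSpace ℝ (Fin d) => y j)
      (EuclideanSpace.proj j : EuclideanSpace ℝ (Fin d) →L[ℝ] ℝ) x :=
    (EuclideanSpace.proj j : EuclideanSpace ℝ (Fin d) →L[ℝ] ℝ).hasFDerivAt
  rw [hev.fderiv_eq,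
    (((hasFDerivAt_norm_rpow_of_ne_zero (p - 2) hx).const_mul p).fun_mul hcoord).fderiv,
    show p - 4 = p - 2 - 2 by ring]
  simp [EuclideanSpace.inner_single_right, Matrix.one_apply, eq_comm]
  ring

/-- The quadratic form of `1 + c • x xᵀ`. -/
theorem sum_mul_one_add_smul_mul {d : ℕ} (c : ℝ) (x ξ : EuclideanSpace ℝ (Fin d)) :
    ∑ i, ∑ j, ξ i * ((1 : Matrix (Fin d) (Fin d) ℝ) +
        c • (Matrix.of fun i j => x i * x j)) i j * ξ j =
      ‖ξ‖ ^ 2 + c * inner ℝ x ξ ^ 2 := by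
  have hinner : inner ℝ x ξ = ∑ i, ξ i * x i := by simp [PiLp.inner_apply]
  rw [hinner, EuclideanSpace.real_norm_sq_eq, sq (∑ i, _), Finset.sum_mul_sum, Finset.mul_sum,
    ← Finset.sum_add_distrib]
  refine Finset.sum_congr rfl fun i _ => ?_
  simp only [Matrix.add_apply, Matrix.smul_apply, Matrix.of_apply, smul_eq_mul, mul_add, add_mul,
    Finset.sum_add_distrib, Matrix.one_apply, Finset.mul_sum]
  congr 1
  · simp [sq]
  · exact Finset.sum_congr rfl fun j _ => by ring

/-- The Frobenius product of `1 + c • x xᵀ` and `α • x xᵀ + β • 1`. -/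
theorem sum_one_add_smul_mul_smul_add {d : ℕ} (c α β : ℝ) (x : EuclideanSpace ℝ (Fin d)) :
    ∑ i, ∑ j, ((1 : Matrix (Fin d) (Fin d) ℝ) + c • (Matrix.of fun i j => x i * x j)) i j *
        (α * (x i * x j) + β * (1 : Matrix (Fin d) (Fin d) ℝ) i j) =
      α * ‖x‖ ^ 2 + β * d + c * (α * (‖x‖ ^ 2) ^ 2 + β * ‖x‖ ^ 2) := by
  have hrow : ∀ i, ∑ j, ((1 : Matrix (Fin d) (Fin d) ℝ) +
        c • (Matrix.of fun i j => x i * x j)) i j *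
        (α * (x i * x j) + β * (1 : Matrix (Fin d) (Fin d) ℝ) i j) =
      α * x i ^ 2 + β + c * (α * (x i ^ 2 * ‖x‖ ^ 2) + β * x i ^ 2) := by
    intro i
    have hterm : ∀ j, ((1 : Matrix (Fin d) (Fin d) ℝ) +
        c • (Matrix.of fun i j => x i * x j)) i j *
        (α * (x i * x j) + β * (1 : Matrix (Fin d) (Fin d) ℝ) i j) =
        (if i = j then α * x i ^ 2 + β + c * β * x i ^ 2 else 0) +
          c * α * x i ^ 2 * x j ^ 2 := by
      intro j
      by_cases h : i = j
      · subst h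
        simp
        ring
      · simp [h]
        ring
    rw [Finset.sum_congr rfl fun j _ => hterm j, Finset.sum_add_distrib, ← Finset.mul_sum,
      ← EuclideanSpace.real_norm_sq_eq]
    simp
    ring
  rw [Finset.sum_congr rfl fun i _ => hrow i]
  simp only [Finset.sum_add_distrib, ← Finset.mul_sum, ← Finset.sum_mul,
    ← EuclideanSpace.real_norm_sq_eq]
  simp
  ring

/-- **Pucci's nonuniqueness example.**  For `d ≥ 3`, `max (2 - d/2) 0 < λ < 1`,
`b = (d - 2 + λ)/(1 - λ)`, `A(x) = I + b (x xᵀ)/|x|²` and `u(x) = |x|^λ - 1`, one has, for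
every `x ≠ 0`: (i) `A(x)` is symmetric with `|ξ|² ≤ ξ·A(x)ξ ≤ (1+b)|ξ|²`;
(ii) `u` is twice differentiable at `x` with Hessian
`D²u(x) = λ(λ-2)|x|^{λ-4} x xᵀ + λ|x|^{λ-2} I`; and (iii) `A(x) : D²u(x) = 0`. -/
theorem pucci_nonuniqueness_example (d : ℕ) (hd : 3 ≤ d)
    (l : ℝ) (hl1 : max (2 - (d:ℝ)/2) 0 < l) (hl2 : l < 1)
    (b : ℝ) (hb : b = ((d:ℝ) - 2 + l) / (1 - l))
    (A : EuclideanSpace ℝ (Fin d) → Matrix (Fin d) (Fin d) ℝ)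
    (hA : ∀ x : EuclideanSpace ℝ (Fin d), x ≠ 0 →
      A x = 1 + (b / ‖x‖ ^ 2) • (Matrix.of fun i j => x i * x j))
    (u : EuclideanSpace ℝ (Fin d) → ℝ)
    (hu : ∀ x : EuclideanSpace ℝ (Fin d), x ≠ 0 → u x = ‖x‖ ^ l - 1) :
    ∀ x : EuclideanSpace ℝ (Fin d), x ≠ 0 →
      -- (i) `A(x)` is symmetric and uniformly elliptic:
      ((A x).IsSymm ∧
        (∀ ξ : EuclideanSpace ℝ (Fin d),
          ‖ξ‖ ^ 2 ≤ ∑ i, ∑ j, ξ i * A x i j * ξ j ∧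
          ∑ i, ∑ j, ξ i * A x i j * ξ j ≤ (1 + b) * ‖ξ‖ ^ 2)) ∧
      -- (ii) `u` is twice (continuously) differentiable at `x`, with the explicit Hessian:
      (ContDiffAt ℝ 2 u x ∧
        (Matrix.of fun i j =>
            fderiv ℝ (fun y => fderiv ℝ u y (EuclideanSpace.single j (1:ℝ))) x
              (EuclideanSpace.single i (1:ℝ)))
          = (l * (l - 2) * ‖x‖ ^ (l - 4)) • (Matrix.of fun i j => x i * x j)
            + (l * ‖x‖ ^ (l - 2)) • (1 : Matrix (Fin d) (Fin d) ℝ)) ∧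
      -- (iii) `u` solves `A : D²u = 0` pointwise at `x`:
      (∑ i, ∑ j, A x i j *
          fderiv ℝ (fun y => fderiv ℝ u y (EuclideanSpace.single j (1:ℝ))) x
            (EuclideanSpace.single i (1:ℝ)) = 0) := by
  intro x hx
  have hl0 : 0 < l := (le_max_right _ _).trans_lt hl1
  have hl : 1 - l ≠ 0 := (sub_pos.2 hl2).ne'
  have hd' : (3 : ℝ) ≤ d := by exact_mod_cast hd
  have hb0 : 0 ≤ b := hb ▸ div_nonneg (by linarith) (by linarith)
  have hnx : 0 < ‖x‖ := norm_pos_iff.2 hx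
  have hc0 : 0 ≤ b / ‖x‖ ^ 2 := by positivity
  have hev : u =ᶠ[nhds x] fun z => ‖z‖ ^ l - 1 := by
    filter_upwards [isOpen_ne.mem_nhds hx] with z hz using hu z hz
  refine ⟨⟨?_, fun ξ => ?_⟩, ⟨?_, ?_⟩, ?_⟩
  · rw [hA x hx]
    ext i j
    simp [Matrix.one_apply, eq_comm, mul_comm]
  · rw [hA x hx, sum_mul_one_add_smul_mul]
    constructor
    · linarith [mul_nonneg hc0 (sq_nonneg (inner ℝ x ξ))]
    · have hcs : inner ℝ x ξ ^ 2 ≤ ‖x‖ ^ 2 * ‖ξ‖ ^ 2 := by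
        rw [← mul_pow]
        exact sq_le_sq' (neg_le_of_abs_le (abs_real_inner_le_norm x ξ)) (real_inner_le_norm x ξ)
      have hbound := mul_le_mul_of_nonneg_left hcs hc0
      have hcancel : b / ‖x‖ ^ 2 * (‖x‖ ^ 2 * ‖ξ‖ ^ 2) = b * ‖ξ‖ ^ 2 := by field_simp
      linarith
  · exact ((contDiffAt_norm_rpow_of_ne_zero l hx).sub contDiffAt_const).congr_of_eventuallyEq hev
  · ext i j
    simp [hessian_norm_rpow_sub_one l hu hx]
  · simp only [hessian_norm_rpow_sub_one l hu hx, hA x hx]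
    rw [sum_one_add_smul_mul_smul_add]
    have hpow : ‖x‖ ^ (l - 2) = ‖x‖ ^ (l - 4) * ‖x‖ ^ 2 := by
      rw [← Real.rpow_natCast, ← Real.rpow_add hnx]
      congr 1
      push_cast
      ring
    rw [hpow, hb]
    field_simp
    ring
end
end

section
/- Hamilton–Jacobi–Bellman reformulation of the Monge–Ampère operator: let d ≥ 1, let f ∈ ℝ with f ≥ 0, and let S^d_1 := { B ∈ S^d : B positive semidefinite and tr B = 1 }. For A ∈ S^d define H(A, f) := sup_{B ∈ S^d_1} ( −(1/d)(B : A) + f^{1/d} · det(B)^{1/d} ). Then H(A, f) = 0 if and only if A is positive semidefinite and det(A) = f. Moreover, if A is positive semidefinite with det(A) = f, then the supremum is attained at some B* ∈ S^d_1 that commutes with A (A B* = B* A). -/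
open scoped BigOperators

noncomputable section

/-- The Hamilton–Jacobi–Bellman operator
`H(A, f) := sup_{B ∈ S^d_1} ( -(1/d)(B : A) + f^{1/d} det(B)^{1/d} )`,
where `S^d_1 = {B ∈ S^d : B ≥ 0, tr B = 1}`. -/
noncomputable def HOp (d : ℕ) (A : Matrix (Fin d) (Fin d) ℝ) (f : ℝ) : ℝ :=
  ⨆ B : {B : Matrix (Fin d) (Fin d) ℝ // B.PosSemidef ∧ B.trace = 1},
    (-(1 / (d:ℝ)) * frob (B : Matrix (Fin d) (Fin d) ℝ) A
      + f ^ ((1:ℝ)/d) * (B : Matrix (Fin d) (Fin d) ℝ).det ^ ((1:ℝ)/d))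

open Matrix MatrixOrder in
/-- A positive semidefinite real matrix is a Gram matrix. -/
theorem exists_eq_conjTranspose_mul_self {d : ℕ} {A : Matrix (Fin d) (Fin d) ℝ}
    (hA : A.PosSemidef) : ∃ S : Matrix (Fin d) (Fin d) ℝ, A = Sᴴ * S :=
  CStarAlgebra.nonneg_iff_eq_star_mul_self.mp hA.nonneg

theorem frob_eq_trace {d : ℕ} {A : Matrix (Fin d) (Fin d) ℝ} (hA : A.IsSymm)
    (B : Matrix (Fin d) (Fin d) ℝ) : frob B A = (A * B).trace := by
  simp only [frob, Matrix.trace, Matrix.diag_apply, Matrix.mul_apply]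
  rw [Finset.sum_comm]
  refine Finset.sum_congr rfl fun i _ => Finset.sum_congr rfl fun j _ => ?_
  rw [← hA.apply i j, mul_comm]

theorem trace_mul_nonneg_of_posSemidef {d : ℕ} {A B : Matrix (Fin d) (Fin d) ℝ}
    (hA : A.PosSemidef) (hB : B.PosSemidef) : 0 ≤ (A * B).trace := by
  obtain ⟨S, rfl⟩ := exists_eq_conjTranspose_mul_self hA
  rw [Matrix.mul_assoc, Matrix.trace_mul_comm]
  exact (hB.mul_mul_conjTranspose_same S).trace_nonneg

/-- The arithmetic-geometric mean inequality for the eigenvalues of a matrix. -/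
theorem det_rpow_le_trace_div {d : ℕ} (hd : 0 < d) {M : Matrix (Fin d) (Fin d) ℝ}
    (hM : M.PosSemidef) : M.det ^ ((1 : ℝ) / d) ≤ 1 / d * M.trace := by
  have hd' : (d : ℝ) ≠ 0 := by positivity
  have h := Real.geom_mean_le_arith_mean_weighted Finset.univ (fun _ : Fin d => (1 : ℝ) / d)
    hM.1.eigenvalues (fun _ _ => by positivity) (by simp [hd'])
    (fun i _ => hM.eigenvalues_nonneg i)
  rw [Real.finsetProd_rpow _ _ fun i _ => hM.eigenvalues_nonneg i, ← Finset.mul_sum] at h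
  rw [hM.1.det_eq_prod_eigenvalues, hM.1.trace_eq_sum_eigenvalues]
  simpa using h

theorem det_rpow_mul_det_rpow_le {d : ℕ} (hd : 0 < d) {A B : Matrix (Fin d) (Fin d) ℝ}
    (hA : A.PosSemidef) (hB : B.PosSemidef) :
    A.det ^ ((1 : ℝ) / d) * B.det ^ ((1 : ℝ) / d) ≤ 1 / d * (A * B).trace := by
  rw [← Real.mul_rpow hA.det_nonneg hB.det_nonneg]
  obtain ⟨S, rfl⟩ := exists_eq_conjTranspose_mul_self hA
  have h := det_rpow_le_trace_div hd (hB.mul_mul_conjTranspose_same S)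
  rw [← Matrix.trace_mul_comm, ← Matrix.mul_assoc] at h
  convert h using 2
  simp only [Matrix.det_mul]
  ring

open MatrixOrder in
/-- Some eigenvalue of `A` bounds `A : B` from below on trace-one matrices `B ≥ 0`. -/
theorem exists_eigenvalue_le_trace_mul {d : ℕ} (hd : 0 < d) {A : Matrix (Fin d) (Fin d) ℝ}
    (hA : A.IsHermitian) : ∃ i, ∀ B : Matrix (Fin d) (Fin d) ℝ, B.PosSemidef → B.trace = 1 →
      hA.eigenvalues i ≤ (A * B).trace := by
  have : Nonempty (Fin d) := ⟨⟨0, hd⟩⟩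
  obtain ⟨i, hi⟩ := Finite.exists_min hA.eigenvalues
  refine ⟨i, fun B hB htr => ?_⟩
  have hle : algebraMap ℝ (Matrix (Fin d) (Fin d) ℝ) (hA.eigenvalues i) ≤ A := by
    refine algebraMap_le_of_le_spectrum (fun x hx => ?_) hA
    rw [hA.spectrum_real_eq_range_eigenvalues] at hx
    obtain ⟨j, rfl⟩ := hx
    exact hi j
  have h := trace_mul_nonneg_of_posSemidef (Matrix.le_iff.mp hle) hB
  rw [sub_mul, Matrix.trace_sub, Algebra.algebraMap_eq_smul_one, smul_mul_assoc, one_mul,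
    Matrix.trace_smul, htr, smul_eq_mul, mul_one] at h
  linarith

/-- The normalised rank-one projection onto the line spanned by `v`. -/
theorem posSemidef_and_trace_smul_vecMulVec {d : ℕ} {v : Fin d → ℝ} (hv : v ≠ 0) :
    ((v ⬝ᵥ v)⁻¹ • Matrix.vecMulVec v v).PosSemidef ∧
      ((v ⬝ᵥ v)⁻¹ • Matrix.vecMulVec v v).trace = 1 := by
  have h0 : v ⬝ᵥ v ≠ 0 := fun h => hv (dotProduct_self_eq_zero.mp h)
  have hnn : 0 ≤ v ⬝ᵥ v := by simpa using dotProduct_star_self_nonneg v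
  refine ⟨?_, ?_⟩
  · have h := Matrix.posSemidef_vecMulVec_self_star v
    rw [star_trivial] at h
    exact h.smul (inv_nonneg.mpr hnn)
  · rw [Matrix.trace_smul, Matrix.trace_vecMulVec, smul_eq_mul, inv_mul_cancel₀ h0]

/-- The normalised inverse of a positive definite matrix. -/
theorem exists_normalized_inv {d : ℕ} (hd : 0 < d) {A : Matrix (Fin d) (Fin d) ℝ}
    (hA : A.PosDef) : ∃ t : ℝ, 0 < t ∧ (t⁻¹ • A⁻¹).PosSemidef ∧ (t⁻¹ • A⁻¹).trace = 1 ∧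
      (A * (t⁻¹ • A⁻¹)).trace = t⁻¹ * d ∧
      A.det ^ ((1 : ℝ) / d) * (t⁻¹ • A⁻¹).det ^ ((1 : ℝ) / d) = t⁻¹ := by
  have : Nonempty (Fin d) := ⟨⟨0, hd⟩⟩
  have ht : 0 < A⁻¹.trace := hA.inv.trace_pos
  have hdet := hA.det_pos
  have hB : (A⁻¹.trace⁻¹ • A⁻¹).PosSemidef := hA.inv.posSemidef.smul (inv_nonneg.mpr ht.le)
  refine ⟨A⁻¹.trace, ht, hB, ?_, ?_, ?_⟩
  · rw [Matrix.trace_smul, smul_eq_mul, inv_mul_cancel₀ ht.ne']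
  · rw [mul_smul_comm, Matrix.mul_nonsing_inv _ hdet.ne'.isUnit, Matrix.trace_smul]
    simp
  · rw [← Real.mul_rpow hdet.le hB.det_nonneg, Matrix.det_smul, Matrix.det_nonsing_inv,
      Ring.inverse_eq_inv', Fintype.card_fin, mul_left_comm, mul_inv_cancel₀ hdet.ne', mul_one,
      one_div, Real.pow_rpow_inv_natCast (inv_nonneg.mpr ht.le) hd.ne']

/-- For `A ≥ 0` the value zero is attained at a matrix commuting with `A`. -/
theorem exists_commuting_maximizer {d : ℕ} (hd : 0 < d) {A : Matrix (Fin d) (Fin d) ℝ}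
    (hA : A.PosSemidef) : ∃ B : Matrix (Fin d) (Fin d) ℝ, B.PosSemidef ∧ B.trace = 1 ∧
      A * B = B * A ∧
      -(1 / (d : ℝ)) * (A * B).trace + A.det ^ ((1 : ℝ) / d) * B.det ^ ((1 : ℝ) / d) = 0 := by
  have hd' : (d : ℝ) ≠ 0 := by positivity
  by_cases h0 : A.det = 0
  · obtain ⟨v, hv, hAv⟩ := Matrix.exists_mulVec_eq_zero_iff.mpr h0
    have hAB : A * ((v ⬝ᵥ v)⁻¹ • Matrix.vecMulVec v v) = 0 := by
      rw [mul_smul_comm, Matrix.mul_vecMulVec, hAv, Matrix.zero_vecMulVec, smul_zero]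
    obtain ⟨hB, htr⟩ := posSemidef_and_trace_smul_vecMulVec hv
    refine ⟨_, hB, htr, ?_, ?_⟩
    · have h := congrArg Matrix.conjTranspose hAB
      rw [Matrix.conjTranspose_mul, hB.1.eq, hA.1.eq, Matrix.conjTranspose_zero] at h
      rw [hAB, h]
    · rw [hAB, h0, Real.zero_rpow (by positivity)]
      simp
  · have hPD : A.PosDef := hA.posDef_iff_det_ne_zero.mpr h0
    obtain ⟨t, ht, hB, htr, h1, h2⟩ := exists_normalized_inv hd hPD
    refine ⟨_, hB, htr, ?_, ?_⟩
    · rw [mul_smul_comm, smul_mul_assoc, Matrix.mul_nonsing_inv _ (Ne.isUnit h0),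
        Matrix.nonsing_inv_mul _ (Ne.isUnit h0)]
    · rw [h1, h2]
      field_simp
      ring

theorem bddAbove_HOp {d : ℕ} (hd : 0 < d) {A : Matrix (Fin d) (Fin d) ℝ} (hA : A.IsSymm)
    {f : ℝ} (hf : 0 ≤ f) : BddAbove (Set.range fun
      B : {B : Matrix (Fin d) (Fin d) ℝ // B.PosSemidef ∧ B.trace = 1} =>
        -(1 / (d : ℝ)) * frob (B : Matrix (Fin d) (Fin d) ℝ) A
          + f ^ ((1 : ℝ) / d) * (B : Matrix (Fin d) (Fin d) ℝ).det ^ ((1 : ℝ) / d)) := by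
  have hH : A.IsHermitian := by
    rwa [Matrix.IsHermitian, Matrix.conjTranspose_eq_transpose_of_trivial]
  obtain ⟨i, hi⟩ := exists_eigenvalue_le_trace_mul hd hH
  refine ⟨-(1 / (d : ℝ)) * hH.eigenvalues i + f ^ ((1 : ℝ) / d) * (1 / d), ?_⟩
  rintro _ ⟨⟨B, hB, htr⟩, rfl⟩
  dsimp only
  have h1 := hi B hB htr
  have h2 := det_rpow_le_trace_div hd hB
  rw [htr, mul_one] at h2
  rw [frob_eq_trace hA, neg_mul, neg_mul]
  gcongr

theorem HOp_eq_zero_of_posSemidef {d : ℕ} (hd : 0 < d) {A : Matrix (Fin d) (Fin d) ℝ}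
    (hA : A.PosSemidef) (hAs : A.IsSymm) : HOp d A A.det = 0 := by
  obtain ⟨B, hB, htr, -, hval⟩ := exists_commuting_maximizer hd hA
  have : Nonempty {B : Matrix (Fin d) (Fin d) ℝ // B.PosSemidef ∧ B.trace = 1} := ⟨⟨B, hB, htr⟩⟩
  refine le_antisymm (ciSup_le fun ⟨C, hC, _⟩ => ?_) ?_
  · have h := det_rpow_mul_det_rpow_le hd hA hC
    rw [frob_eq_trace hAs]
    linarith
  · refine le_trans ?_ (le_ciSup (bddAbove_HOp hd hAs hA.det_nonneg) ⟨B, hB, htr⟩)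
    rw [frob_eq_trace hAs, hval]

theorem posSemidef_of_HOp_nonpos {d : ℕ} (hd : 0 < d) {A : Matrix (Fin d) (Fin d) ℝ}
    (hAs : A.IsSymm) {f : ℝ} (hf : 0 ≤ f) (h : HOp d A f ≤ 0) : A.PosSemidef := by
  have hH : A.IsHermitian := by
    rwa [Matrix.IsHermitian, Matrix.conjTranspose_eq_transpose_of_trivial]
  have hdpos : (0 : ℝ) < 1 / d := by positivity
  refine Matrix.PosSemidef.of_dotProduct_mulVec_nonneg hH fun v => ?_
  rcases eq_or_ne v 0 with rfl | hv
  · simp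
  obtain ⟨hB, htr⟩ := posSemidef_and_trace_smul_vecMulVec hv
  have hle := (le_ciSup (bddAbove_HOp hd hAs hf) ⟨_, hB, htr⟩).trans h
  dsimp only at hle
  have hdet : 0 ≤ f ^ ((1 : ℝ) / d) *
      ((v ⬝ᵥ v)⁻¹ • Matrix.vecMulVec v v).det ^ ((1 : ℝ) / d) :=
    mul_nonneg (Real.rpow_nonneg hf _) (Real.rpow_nonneg hB.det_nonneg _)
  have hvv : 0 < (v ⬝ᵥ v)⁻¹ := by
    refine inv_pos.mpr (lt_of_le_of_ne ?_ fun h => hv (dotProduct_self_eq_zero.mp h.symm))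
    simpa using dotProduct_star_self_nonneg v
  rw [frob_eq_trace hAs, mul_smul_comm, Matrix.mul_vecMulVec, Matrix.trace_smul,
    Matrix.trace_vecMulVec, smul_eq_mul] at hle
  have hnn : 0 ≤ (v ⬝ᵥ v)⁻¹ * (A.mulVec v ⬝ᵥ v) := by
    by_contra! hneg
    nlinarith
  rw [star_trivial, dotProduct_comm]
  exact nonneg_of_mul_nonneg_right hnn hvv

theorem le_det_of_HOp_nonpos {d : ℕ} (hd : 0 < d) {A : Matrix (Fin d) (Fin d) ℝ}
    (hA : A.PosSemidef) (hAs : A.IsSymm) {f : ℝ} (hf : 0 ≤ f) (h : HOp d A f ≤ 0) :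
    f ≤ A.det := by
  have hd' : (0 : ℝ) < d := by positivity
  have hpert : ∀ ε : ℝ, 0 < ε → f ≤ (A + ε • (1 : Matrix (Fin d) (Fin d) ℝ)).det := by
    intro ε hε
    have hPD : (A + ε • (1 : Matrix (Fin d) (Fin d) ℝ)).PosDef :=
      Matrix.PosDef.posSemidef_add hA (Matrix.PosDef.one.smul hε)
    obtain ⟨t, ht, hB, htr, h1, h2⟩ := exists_normalized_inv hd hPD
    set B := t⁻¹ • (A + ε • (1 : Matrix (Fin d) (Fin d) ℝ))⁻¹
    have hle := (le_ciSup (bddAbove_HOp hd hAs hf) ⟨B, hB, htr⟩).trans h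
    dsimp only at hle
    rw [frob_eq_trace hAs] at hle
    rw [add_mul, Matrix.trace_add, smul_mul_assoc, one_mul, Matrix.trace_smul, htr, smul_eq_mul,
      mul_one] at h1
    have h3 : (A * B).trace ≤ t⁻¹ * d := by linarith
    have h4 : 1 / (d : ℝ) * (A * B).trace ≤ t⁻¹ := by
      rw [one_div, inv_mul_le_iff₀ hd']
      linarith
    have h5 := Real.rpow_nonneg hB.det_nonneg ((1 : ℝ) / d)
    have hdpos : 0 < B.det ^ ((1 : ℝ) / d) := by
      refine lt_of_le_of_ne h5 fun h0 => ?_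
      rw [← h0, mul_zero] at h2
      exact (inv_pos.mpr ht).ne h2
    have h6 : f ^ ((1 : ℝ) / d) * B.det ^ ((1 : ℝ) / d) ≤
        (A + ε • (1 : Matrix (Fin d) (Fin d) ℝ)).det ^ ((1 : ℝ) / d) *
          B.det ^ ((1 : ℝ) / d) := by linarith
    exact (Real.rpow_le_rpow_iff hf hPD.det_pos.le (by positivity)).mp
      (le_of_mul_le_mul_right h6 hdpos)
  have hcont : Continuous fun ε : ℝ => (A + ε • (1 : Matrix (Fin d) (Fin d) ℝ)).det := by
    fun_prop
  have hlim := (hcont.tendsto 0).mono_left (nhdsWithin_le_nhds (s := Set.Ioi 0))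
  simp only [zero_smul, add_zero] at hlim
  exact ge_of_tendsto hlim (Filter.eventually_of_mem self_mem_nhdsWithin hpert)

theorem det_le_of_HOp_nonneg {d : ℕ} (hd : 0 < d) {A : Matrix (Fin d) (Fin d) ℝ}
    (hA : A.PosSemidef) (hAs : A.IsSymm) {f : ℝ} (hf : 0 ≤ f) (h : 0 ≤ HOp d A f) :
    A.det ≤ f := by
  by_contra! hlt
  have hPD : A.PosDef := hA.posDef_iff_det_ne_zero.mpr (hf.trans_lt hlt).ne'
  obtain ⟨i, hi⟩ := exists_eigenvalue_le_trace_mul hd hA.1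
  have hev := hPD.eigenvalues_pos i
  obtain ⟨B, hB, htr, -⟩ := exists_commuting_maximizer hd hA
  have : Nonempty {B : Matrix (Fin d) (Fin d) ℝ // B.PosSemidef ∧ B.trace = 1} := ⟨⟨B, hB, htr⟩⟩
  have hd0 : (0 : ℝ) < 1 / d := by positivity
  have hroot : f ^ ((1 : ℝ) / d) < A.det ^ ((1 : ℝ) / d) := Real.rpow_lt_rpow hf hlt hd0
  have hroot0 := Real.rpow_nonneg hf ((1 : ℝ) / d)
  set a := A.det ^ ((1 : ℝ) / d)
  set b := f ^ ((1 : ℝ) / d)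
  have ha : 0 < a := hroot0.trans_lt hroot
  have hr : 0 < 1 - b / a := sub_pos.mpr ((div_lt_one ha).mpr hroot)
  have hsup : HOp d A f ≤ -(1 / d * hA.1.eigenvalues i * (1 - b / a)) := by
    refine ciSup_le fun ⟨C, hC, hCtr⟩ => ?_
    have h1 := det_rpow_mul_det_rpow_le hd hA hC
    rw [frob_eq_trace hAs]
    have h2 : b * C.det ^ ((1 : ℝ) / d) ≤ b / a * (1 / d * (A * C).trace) := by
      calc b * C.det ^ ((1 : ℝ) / d) = b / a * (a * C.det ^ ((1 : ℝ) / d)) := by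
            field_simp
        _ ≤ _ := by gcongr
    have h3 : 1 / d * hA.1.eigenvalues i * (1 - b / a) ≤
        1 / d * (A * C).trace * (1 - b / a) := by
      have := hi C hC hCtr
      gcongr
    change -(1 / (d : ℝ)) * (A * C).trace + b * C.det ^ ((1 : ℝ) / d) ≤ _
    linarith
  have : 0 < 1 / d * hA.1.eigenvalues i * (1 - b / a) := by positivity
  linarith

/-- **HJB reformulation of the Monge–Ampère operator.**  For `d ≥ 1`, `f ≥ 0` and
symmetric `A`:  `H(A,f) = 0` iff `A` is positive semidefinite and `det A = f`; moreover in
that case the supremum is attained at some `B* ∈ S^d_1` commuting with `A`. -/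
theorem hjb_monge_ampere (d : ℕ) (hd : 0 < d) (f : ℝ) (hf : 0 ≤ f)
    (A : Matrix (Fin d) (Fin d) ℝ) (hAs : A.IsSymm) :
    (HOp d A f = 0 ↔ A.PosSemidef ∧ A.det = f) ∧
    (A.PosSemidef → A.det = f →
      ∃ B : Matrix (Fin d) (Fin d) ℝ, B.PosSemidef ∧ B.trace = 1 ∧
        A * B = B * A ∧
        -(1 / (d:ℝ)) * frob B A + f ^ ((1:ℝ)/d) * B.det ^ ((1:ℝ)/d) = HOp d A f) := by
  refine ⟨⟨fun h => ?_, ?_⟩, ?_⟩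
  · have hA := posSemidef_of_HOp_nonpos hd hAs hf h.le
    exact ⟨hA, le_antisymm (det_le_of_HOp_nonneg hd hA hAs hf h.ge)
      (le_det_of_HOp_nonpos hd hA hAs hf h.le)⟩
  · rintro ⟨hA, rfl⟩
    exact HOp_eq_zero_of_posSemidef hd hA hAs
  · rintro hA rfl
    obtain ⟨B, hB, htr, hcomm, hval⟩ := exists_commuting_maximizer hd hA
    refine ⟨B, hB, htr, hcomm, ?_⟩
    rw [frob_eq_trace hAs, hval, HOp_eq_zero_of_posSemidef hd hA hAs]
end
end

section
/- Finite difference Alexandrov estimate: there exists a constant C > 0 depending only on the dimension d such that for every h > 0, R > 0, every finite node set Ω̄_h ⊆ hℤ^d ∩ B_R(0) partitioned into interior nodes Ω_h^I and boundary nodes Ω_h^B, and every nodal function v : Ω̄_h → ℝ with v(z) ≥ 0 for all z ∈ Ω_h^B, one has sup_{z ∈ Ω̄_h} v⁻(z) ≤ C · R · ( Σ_{z ∈ 𝒞_h⁻(v)} |∂Γ_h(v)(z)| )^{1/d}. -/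
open scoped BigOperators Classical

noncomputable section

/-- `z` belongs to the lattice `hℤ^d`. -/
def IsLatticePt {d : ℕ} (h : ℝ) (z : EuclideanSpace ℝ (Fin d)) : Prop :=
  ∀ i, ∃ m : ℤ, z i = h * m

/-- Negative part `t⁻ = max (-t) 0`. -/
def nPart (t : ℝ) : ℝ := max (-t) 0

/-- The function `-v⁻` (with `v` regarded as a nodal function on `Ωh`) extended by zero. -/
def extNeg {d : ℕ} (Ωh : Finset (EuclideanSpace ℝ (Fin d)))
    (v : EuclideanSpace ℝ (Fin d) → ℝ) (ζ : EuclideanSpace ℝ (Fin d)) : ℝ :=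
  if ζ ∈ Ωh then -nPart (v ζ) else 0

/-- The discrete convex envelope `Γ_h(v)` of (the extension by zero of) `-v⁻`:
`Γ_h(v)(x) = sup { L(x) : L affine, L(ζ) ≤ -v⁻(ζ) for all ζ ∈ B_{R,h} = B_R(0) ∩ hℤ^d }`. -/
def discEnv {d : ℕ} (h R : ℝ) (Ωh : Finset (EuclideanSpace ℝ (Fin d)))
    (v : EuclideanSpace ℝ (Fin d) → ℝ) (x : EuclideanSpace ℝ (Fin d)) : ℝ :=
  sSup {t : ℝ | ∃ (p : EuclideanSpace ℝ (Fin d)) (c : ℝ),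
    (∀ ζ : EuclideanSpace ℝ (Fin d), IsLatticePt h ζ → ‖ζ‖ < R →
      (∑ i, p i * ζ i) + c ≤ extNeg Ωh v ζ) ∧
    t = (∑ i, p i * x i) + c}

/-- The subdifferential
`∂Γ_h(v)(z) = {p : Γ_h(v)(x) ≥ Γ_h(v)(z) + p·(x - z) for all x ∈ B_R(0)}`. -/
def envSubdiff {d : ℕ} (h R : ℝ) (Ωh : Finset (EuclideanSpace ℝ (Fin d)))
    (v : EuclideanSpace ℝ (Fin d) → ℝ) (z : EuclideanSpace ℝ (Fin d)) :
    Set (EuclideanSpace ℝ (Fin d)) :=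
  {p | ∀ x : EuclideanSpace ℝ (Fin d), ‖x‖ < R →
    discEnv h R Ωh v z + ∑ i, p i * (x i - z i) ≤ discEnv h R Ωh v x}

/-- The (lower) nodal contact set `𝒞_h⁻(v) = {z ∈ Ω_h^I : Γ_h(v)(z) = v(z)}`. -/
def contactSet {d : ℕ} (h R : ℝ) (ΩI Ωh : Finset (EuclideanSpace ℝ (Fin d)))
    (v : EuclideanSpace ℝ (Fin d) → ℝ) : Finset (EuclideanSpace ℝ (Fin d)) :=
  ΩI.filter (fun z => discEnv h R Ωh v z = v z)

lemma sum_mul_sub_le {d : ℕ} (p x y : EuclideanSpace ℝ (Fin d)) :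
    ∑ i, p i * (x i - y i) ≤ ‖p‖ * ‖x - y‖ := by
  have h := real_inner_le_norm p (x - y)
  rw [PiLp.inner_apply] at h
  simpa [mul_comm] using h

lemma nPart_nonneg (t : ℝ) : 0 ≤ nPart t := le_max_right _ _

/-- The envelope lies below the extended nodal function at every lattice point of the ball. -/
lemma discEnv_le {d : ℕ} {h R : ℝ} {Ωh : Finset (EuclideanSpace ℝ (Fin d))}
    {v : EuclideanSpace ℝ (Fin d) → ℝ} {z : EuclideanSpace ℝ (Fin d)}
    (hz : IsLatticePt h z) (hzR : ‖z‖ < R) (c : ℝ)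
    (hc : ∀ ζ : EuclideanSpace ℝ (Fin d), IsLatticePt h ζ → ‖ζ‖ < R → c ≤ extNeg Ωh v ζ) :
    discEnv h R Ωh v z ≤ extNeg Ωh v z := by
  refine csSup_le ⟨c, 0, c, fun ζ h1 h2 => by simpa using hc ζ h1 h2, by simp⟩ ?_
  rintro t ⟨p, c, hp, rfl⟩
  exact hp z hz hzR

/-- An admissible affine function lies below the envelope wherever it is nonpositive. -/
lemma le_discEnv {d : ℕ} {h R : ℝ} {Ωh : Finset (EuclideanSpace ℝ (Fin d))}
    {v : EuclideanSpace ℝ (Fin d) → ℝ} {x : EuclideanSpace ℝ (Fin d)}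
    (p : EuclideanSpace ℝ (Fin d)) (c : ℝ)
    (hp : ∀ ζ : EuclideanSpace ℝ (Fin d), IsLatticePt h ζ → ‖ζ‖ < R →
      (∑ i, p i * ζ i) + c ≤ extNeg Ωh v ζ)
    (hx : (∑ i, p i * x i) + c ≤ 0) :
    (∑ i, p i * x i) + c ≤ discEnv h R Ωh v x := by
  unfold discEnv
  by_cases hb : BddAbove {t : ℝ | ∃ (p : EuclideanSpace ℝ (Fin d)) (c : ℝ),
      (∀ ζ : EuclideanSpace ℝ (Fin d), IsLatticePt h ζ → ‖ζ‖ < R →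
        (∑ i, p i * ζ i) + c ≤ extNeg Ωh v ζ) ∧
      t = (∑ i, p i * x i) + c}
  · exact le_csSup hb ⟨p, c, hp, rfl⟩
  · rwa [Real.sSup_of_not_bddAbove hb]

/-- At a point of the open ball the subdifferential of the envelope is bounded. -/
lemma isBounded_envSubdiff {d : ℕ} {h R : ℝ} {Ωh : Finset (EuclideanSpace ℝ (Fin d))}
    {v : EuclideanSpace ℝ (Fin d) → ℝ} {z : EuclideanSpace ℝ (Fin d)} (hzR : ‖z‖ < R) :
    Bornology.IsBounded (envSubdiff h R Ωh v z) := by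
  obtain ⟨ε, hε, hεR⟩ : ∃ ε : ℝ, 0 < ε ∧ ‖z‖ + ε < R :=
    ⟨(R - ‖z‖) / 2, by linarith, by linarith⟩
  have key : ∀ p ∈ envSubdiff h R Ωh v z, ∀ (i : Fin d) (s : ℝ), |s| = ε →
      p i * s ≤ discEnv h R Ωh v (z + EuclideanSpace.single i s) - discEnv h R Ωh v z := by
    intro p hp i s hs
    have hx : ‖z + EuclideanSpace.single i s‖ < R := by
      refine (norm_add_le _ _).trans_lt ?_
      simpa [hs] using hεR
    have h1 := hp _ hx
    simp at h1
    linarith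
  set B : Fin d → ℝ := fun i =>
    (|discEnv h R Ωh v (z + EuclideanSpace.single i ε) - discEnv h R Ωh v z| +
      |discEnv h R Ωh v (z + EuclideanSpace.single i (-ε)) - discEnv h R Ωh v z|) / ε with hB
  refine isBounded_iff_forall_norm_le.2 ⟨√(∑ i, B i ^ 2), fun p hp => ?_⟩
  rw [EuclideanSpace.norm_eq]
  refine Real.sqrt_le_sqrt (Finset.sum_le_sum fun i _ => ?_)
  refine pow_le_pow_left₀ (norm_nonneg _) ?_ 2
  have h1 := (key p hp i ε (abs_of_pos hε)).trans (le_abs_self _)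
  have h2 := (key p hp i (-ε) (by rw [abs_neg, abs_of_pos hε])).trans (le_abs_self _)
  rw [hB, le_div_iff₀ hε, Real.norm_eq_abs, ← abs_of_pos hε, ← abs_mul, abs_of_pos hε]
  refine abs_le.2 ⟨?_, ?_⟩
  · have := abs_nonneg (discEnv h R Ωh v (z + EuclideanSpace.single i ε) - discEnv h R Ωh v z)
    linarith
  · have := abs_nonneg
      (discEnv h R Ωh v (z + EuclideanSpace.single i (-ε)) - discEnv h R Ωh v z)
    linarith

/-- Every slope smaller than `v⁻(z₀) / (2R)` is a subgradient at some contact node. -/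
lemma ball_subset_biUnion_envSubdiff {d : ℕ} {h R : ℝ} (hR : 0 < R)
    {ΩI ΩB : Finset (EuclideanSpace ℝ (Fin d))}
    (hΩ : ∀ z ∈ ΩI ∪ ΩB, IsLatticePt h z ∧ ‖z‖ < R)
    {v : EuclideanSpace ℝ (Fin d) → ℝ} (hv : ∀ z ∈ ΩB, 0 ≤ v z)
    {z₀ : EuclideanSpace ℝ (Fin d)} (hz₀ : z₀ ∈ ΩI ∪ ΩB) :
    Metric.ball (0 : EuclideanSpace ℝ (Fin d)) (nPart (v z₀) / (2 * R)) ⊆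
      ⋃ z ∈ contactSet h R ΩI (ΩI ∪ ΩB) v, envSubdiff h R (ΩI ∪ ΩB) v z := by
  intro p hp
  rw [mem_ball_zero_iff, lt_div_iff₀ (by positivity)] at hp
  have hsmall : ∀ x : EuclideanSpace ℝ (Fin d), ‖x‖ < R →
      (∑ i, p i * x i) - ∑ i, p i * z₀ i < nPart (v z₀) := by
    intro x hx
    have h1 := sum_mul_sub_le p x z₀
    simp only [mul_sub, Finset.sum_sub_distrib] at h1
    have h2 : ‖x - z₀‖ ≤ 2 * R := by
      have := norm_sub_le x z₀
      have := (hΩ z₀ hz₀).2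
      linarith
    have h3 := mul_le_mul_of_nonneg_left h2 (norm_nonneg p)
    linarith
  obtain ⟨z, hz, hmin⟩ := Finset.exists_min_image (ΩI ∪ ΩB)
    (fun ζ => -nPart (v ζ) - ∑ i, p i * ζ i) ⟨z₀, hz₀⟩
  have hzmin := hmin z₀ hz₀
  have hzpos : 0 < nPart (v z) := by
    have := hsmall z (hΩ z hz).2
    linarith
  have hvz : v z < 0 := by
    unfold nPart at hzpos
    by_contra! hcon
    rw [max_eq_right (by linarith)] at hzpos
    exact lt_irrefl _ hzpos
  have hvz' : nPart (v z) = -v z := max_eq_left (by linarith)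
  have hzI : z ∈ ΩI := (Finset.mem_union.1 hz).resolve_right fun hB => by
    have := hv z hB
    linarith
  have hext : extNeg (ΩI ∪ ΩB) v z = v z := by
    rw [extNeg, if_pos hz, hvz', neg_neg]
  have hadm : ∀ ζ : EuclideanSpace ℝ (Fin d), IsLatticePt h ζ → ‖ζ‖ < R →
      (∑ i, p i * ζ i) + (v z - ∑ i, p i * z i) ≤ extNeg (ΩI ∪ ΩB) v ζ := by
    intro ζ _ hζR
    unfold extNeg
    split_ifs with hζ
    · have := hmin ζ hζ
      linarith
    · have := hsmall ζ hζR
      linarith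
  obtain ⟨c, hc⟩ : ∃ c : ℝ, ∀ ζ : EuclideanSpace ℝ (Fin d), IsLatticePt h ζ → ‖ζ‖ < R →
      c ≤ extNeg (ΩI ∪ ΩB) v ζ := by
    refine ⟨-∑ ζ ∈ ΩI ∪ ΩB, nPart (v ζ), fun ζ _ _ => ?_⟩
    unfold extNeg
    split_ifs with hζ
    · exact neg_le_neg (Finset.single_le_sum (f := fun ζ => nPart (v ζ))
        (fun i _ => nPart_nonneg _) hζ)
    · exact neg_nonpos.2 (Finset.sum_nonneg fun i _ => nPart_nonneg _)
  have hbelow : ∀ x : EuclideanSpace ℝ (Fin d), ‖x‖ < R →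
      (∑ i, p i * x i) + (v z - ∑ i, p i * z i) ≤ discEnv h R (ΩI ∪ ΩB) v x := by
    intro x hx
    refine le_discEnv p _ hadm ?_
    have := hsmall x hx
    linarith
  have hcontact : discEnv h R (ΩI ∪ ΩB) v z = v z := by
    refine le_antisymm ((discEnv_le (hΩ z hz).1 (hΩ z hz).2 c hc).trans_eq hext) ?_
    have := hbelow z (hΩ z hz).2
    linarith
  refine Set.mem_iUnion₂.2 ⟨z, Finset.mem_filter.2 ⟨hzI, hcontact⟩, fun x hx => ?_⟩
  have := hbelow x hx
  rw [hcontact]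
  simp only [mul_sub, Finset.sum_sub_distrib]
  linarith

/-- **Finite difference Alexandrov estimate.**  There is a constant `C > 0` depending only
on the dimension `d` such that for every `h, R > 0`, every finite node set
`Ω̄_h = Ω_h^I ∪ Ω_h^B ⊆ hℤ^d ∩ B_R(0)` and every nodal function `v` with `v ≥ 0` on
`Ω_h^B`:  `sup_{Ω̄_h} v⁻ ≤ C R (∑_{z ∈ 𝒞_h⁻(v)} |∂Γ_h(v)(z)|)^{1/d}`. -/
theorem fd_alexandrov_estimate (d : ℕ) (hd : 0 < d) :
    ∃ C : ℝ, 0 < C ∧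
      ∀ (h R : ℝ), 0 < h → 0 < R →
      ∀ ΩI ΩB : Finset (EuclideanSpace ℝ (Fin d)),
        Disjoint ΩI ΩB →
        (∀ z ∈ ΩI ∪ ΩB, IsLatticePt h z ∧ ‖z‖ < R) →
        ∀ v : EuclideanSpace ℝ (Fin d) → ℝ,
          (∀ z ∈ ΩB, 0 ≤ v z) →
          ∀ z ∈ ΩI ∪ ΩB,
            nPart (v z) ≤ C * R *
              (∑ z' ∈ contactSet h R ΩI (ΩI ∪ ΩB) v,
                (MeasureTheory.volume (envSubdiff h R (ΩI ∪ ΩB) v z')).toReal) ^ ((1:ℝ)/d) := by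
  set ω : ℝ := (MeasureTheory.volume
    (Metric.ball (0 : EuclideanSpace ℝ (Fin d)) 1)).toReal with hω
  have hωpos : 0 < ω := ENNReal.toReal_pos
    (Metric.measure_ball_pos _ _ one_pos).ne' MeasureTheory.measure_ball_lt_top.ne
  refine ⟨2 * (ω ^ ((1 : ℝ) / d))⁻¹, by positivity, ?_⟩
  intro h R _ hR ΩI ΩB _ hΩ v hv z hz
  set S := ∑ z' ∈ contactSet h R ΩI (ΩI ∪ ΩB) v,
    (MeasureTheory.volume (envSubdiff h R (ΩI ∪ ΩB) v z')).toReal with hS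
  set r := nPart (v z) / (2 * R) with hr
  have hr0 : 0 ≤ r := div_nonneg (nPart_nonneg _) (by positivity)
  have hfin : ∀ z' ∈ contactSet h R ΩI (ΩI ∪ ΩB) v,
      MeasureTheory.volume (envSubdiff h R (ΩI ∪ ΩB) v z') ≠ ⊤ := fun z' hz' =>
    (isBounded_envSubdiff (hΩ z' (Finset.mem_union_left _
      (Finset.mem_filter.1 hz').1)).2).measure_lt_top.ne
  have hvol : r ^ d * ω ≤ S := by
    have : NeZero d := ⟨hd.ne'⟩
    have h1 := (MeasureTheory.measure_mono (μ := MeasureTheory.volume)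
      (ball_subset_biUnion_envSubdiff hR hΩ hv hz)).trans
      (MeasureTheory.measure_biUnion_finset_le _ _)
    have h2 := ENNReal.toReal_mono (ENNReal.sum_ne_top.2 hfin) h1
    rwa [ENNReal.toReal_sum hfin, MeasureTheory.Measure.addHaar_ball _ _ hr0,
      ENNReal.toReal_mul, ENNReal.toReal_ofReal (by positivity),
      finrank_euclideanSpace_fin] at h2
  have hroot : r * ω ^ ((1 : ℝ) / d) ≤ S ^ ((1 : ℝ) / d) := by
    have h1 := Real.rpow_le_rpow (by positivity) hvol (by positivity : (0 : ℝ) ≤ 1 / d)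
    rwa [Real.mul_rpow (by positivity) hωpos.le, one_div, Real.pow_rpow_inv_natCast hr0 hd.ne',
      ← one_div] at h1
  have hωd : 0 < ω ^ ((1 : ℝ) / d) := by positivity
  calc nPart (v z) = 2 * R * r := by rw [hr]; field_simp
    _ ≤ 2 * R * (S ^ ((1 : ℝ) / d) / ω ^ ((1 : ℝ) / d)) := by
      gcongr
      rwa [le_div_iff₀ hωd]
    _ = _ := by ring
end
end

section
/- Discrete comparison principle for monotone schemes with a strict zero-order term: in the shared grid setting, suppose 𝔉 is of nonnegative type and there is c̄ > 0 such that 𝔉(z, r + t, q + t·𝟙) ≤ 𝔉(z, r, q) − c̄ t for all z ∈ ℝ^d, r ∈ ℝ, q ∈ ℝ^S and t ≥ 0, where 𝟙 ∈ ℝ^S is the all-ones vector. Let v, w : hℤ^d → ℝ be bounded grid functions with F_h[v](z) ≥ 0 and F_h[w](z) ≤ 0 for every z ∈ hℤ^d (v a discrete subsolution, w a discrete supersolution), and assume sup_{z ∈ hℤ^d} ( v(z) − w(z) ) is attained at some node. Then v(z) ≤ w(z) for all z ∈ hℤ^d. -/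
open scoped BigOperators

noncomputable section

/-- **Discrete comparison principle for monotone schemes with a strict zero-order term.**
Fix a grid scale `h > 0` and a finite stencil `S ⊆ ℤ^d ∖ {0}`.  Grid functions on `hℤ^d`
are indexed by `ℤ^d` (the node `z` representing the point `hz`), and
`F_h[u](z) = 𝔉(hz, u(z), (u(z+y))_{y∈S})`.  Assume `𝔉` is of nonnegative type and
satisfies `𝔉(z, r + t, q + t·𝟙) ≤ 𝔉(z, r, q) - c̄ t` for all `t ≥ 0`, with `c̄ > 0`.
If `v, w` are bounded grid functions with `F_h[v] ≥ 0` and `F_h[w] ≤ 0` everywhere, and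
`sup (v - w)` is attained, then `v ≤ w`. -/
theorem discrete_comparison_principle (d : ℕ) (h : ℝ) (hh : 0 < h)
    (S : Finset (Fin d → ℤ)) (hS0 : ∀ y ∈ S, y ≠ 0)
    (𝔉 : (Fin d → ℝ) → ℝ → (↥S → ℝ) → ℝ)
    -- `𝔉` is of nonnegative type:
    (hnn : ∀ (z : Fin d → ℤ) (r t : ℝ) (q τ : ↥S → ℝ),
        (∀ y : ↥S, 0 ≤ τ y ∧ τ y ≤ t) →
        𝔉 (fun i => h * (z i : ℝ)) r q ≤ 𝔉 (fun i => h * (z i : ℝ)) r (q + τ) ∧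
        𝔉 (fun i => h * (z i : ℝ)) (r + t) (q + τ) ≤ 𝔉 (fun i => h * (z i : ℝ)) r q)
    -- strict monotonicity in the zero-order argument:
    (cbar : ℝ) (hc : 0 < cbar)
    (hdecay : ∀ (z : Fin d → ℤ) (r : ℝ) (q : ↥S → ℝ) (t : ℝ), 0 ≤ t →
        𝔉 (fun i => h * (z i : ℝ)) (r + t) (q + fun _ => t)
          ≤ 𝔉 (fun i => h * (z i : ℝ)) r q - cbar * t)
    (v w : (Fin d → ℤ) → ℝ)
    -- `v` and `w` are bounded:
    (hvbdd : ∃ Mv : ℝ, ∀ z, |v z| ≤ Mv) (hwbdd : ∃ Mw : ℝ, ∀ z, |w z| ≤ Mw)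
    -- `v` is a discrete subsolution:
    (hsub : ∀ z : Fin d → ℤ,
      0 ≤ 𝔉 (fun i => h * (z i : ℝ)) (v z) (fun y => v (z + (y : Fin d → ℤ))))
    -- `w` is a discrete supersolution:
    (hsup : ∀ z : Fin d → ℤ,
      𝔉 (fun i => h * (z i : ℝ)) (w z) (fun y => w (z + (y : Fin d → ℤ))) ≤ 0)
    -- `sup (v - w)` is attained at some node:
    (hattain : ∃ z₀ : Fin d → ℤ, ∀ z : Fin d → ℤ, v z - w z ≤ v z₀ - w z₀) :
    ∀ z : Fin d → ℤ, v z ≤ w z := by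
  obtain ⟨z₀, hz₀⟩ := hattain
  by_contra! hlt
  obtain ⟨z₁, hz₁⟩ := hlt
  have hmax_pos : 0 < v z₀ - w z₀ := by linarith [hz₀ z₁]
  let τ : ↥S → ℝ := fun y =>
    w (z₀ + (y : Fin d → ℤ)) + (v z₀ - w z₀) - v (z₀ + (y : Fin d → ℤ))
  have hτ_nonneg : ∀ y, 0 ≤ τ y := fun y => by
    have := hz₀ (z₀ + (y : Fin d → ℤ))
    simp only [τ]
    linarith
  have hmono := (hnn z₀ (v z₀) (∑ y, τ y) (fun y => v (z₀ + (y : Fin d → ℤ))) τ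
    fun y => ⟨hτ_nonneg y,
      Finset.single_le_sum (fun i _ => hτ_nonneg i) (Finset.mem_univ y)⟩).1
  have hshift : (fun y : ↥S => v (z₀ + (y : Fin d → ℤ))) + τ
      = (fun y : ↥S => w (z₀ + (y : Fin d → ℤ))) + fun _ => v z₀ - w z₀ := by
    ext y
    simp [τ]
  have hstrict := hdecay z₀ (w z₀) (fun y => w (z₀ + (y : Fin d → ℤ))) _ hmax_pos.le
  rw [add_sub_cancel, ← hshift] at hstrict
  linarith [hsub z₀, hsup z₀, mul_pos hc hmax_pos]
end
end

section
/- Convergence of the two-level Howard algorithm for discrete Isaacs equations: let 𝒜, ℬ be nonempty finite sets, N ≥ 1, and for each (α,β) ∈ 𝒜×ℬ let K^{α,β} be a real N×N matrix and f^{α,β} ∈ ℝ^N. For b ∈ ℬ^N define F^b : ℝ^N → ℝ^N by F^b(w)_i := max_{α∈𝒜} ( K^{α,b_i} w − f^{α,b_i} )_i, and define F : ℝ^N → ℝ^N by F(w)_i := min_{β∈ℬ} max_{α∈𝒜} ( K^{α,β} w − f^{α,β} )_i (so F(w) ≤ F^b(w) componentwise for every b and w). Assume that for every b ∈ ℬ^N: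 (i) there exists x ∈ ℝ^N with F^b(x) = 0, and (ii) F^b(u) ≤ F^b(v) componentwise implies u ≥ v componentwise. Let x_{−1} ∈ ℝ^N be arbitrary and, for k ≥ 0, choose b_k ∈ ℬ^N with F^{b_k}(x_{k−1}) = F(x_{k−1}) (a componentwise minimizing selection) and let x_k satisfy F^{b_k}(x_k) = 0. Then x_k ≥ x_{k+1} componentwise for every k ≥ 0, and there exists k ≤ (#ℬ)^N with F(x_k) = 0, i.e. the algorithm reaches a solution of the discrete Isaacs equation in at most (#ℬ)^N steps. -/
open scoped BigOperators

noncomputable section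

/-- For a control vector `b ∈ ℬ^N`, the Hamilton–Jacobi–Bellman-type operator
`F^b(w)_i := max_{α ∈ 𝒜} (K^{α,b_i} w - f^{α,b_i})_i`. -/
noncomputable def FbOp {A B : Type*} [Fintype A] [Nonempty A] {N : ℕ}
    (K : A → B → Matrix (Fin N) (Fin N) ℝ) (f : A → B → Fin N → ℝ)
    (b : Fin N → B) (w : Fin N → ℝ) : Fin N → ℝ :=
  fun i => ⨆ α : A, ((K α (b i)).mulVec w - f α (b i)) i

/-- The discrete Isaacs operator `F(w)_i := min_{β ∈ ℬ} max_{α ∈ 𝒜} (K^{α,β} w - f^{α,β})_i`. -/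
noncomputable def FIsaacsOp {A B : Type*} [Fintype A] [Nonempty A] [Fintype B] [Nonempty B]
    {N : ℕ} (K : A → B → Matrix (Fin N) (Fin N) ℝ) (f : A → B → Fin N → ℝ)
    (w : Fin N → ℝ) : Fin N → ℝ :=
  fun i => ⨅ β : B, ⨆ α : A, ((K α β).mulVec w - f α β) i

theorem FIsaacsOp_le_FbOp {A B : Type*} [Fintype A] [Nonempty A] [Fintype B] [Nonempty B]
    {N : ℕ} (K : A → B → Matrix (Fin N) (Fin N) ℝ) (f : A → B → Fin N → ℝ)
    (b : Fin N → B) (w : Fin N → ℝ) : FIsaacsOp K f w ≤ FbOp K f b w :=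
  fun i => ciInf_le (Set.finite_range _).bddBelow (b i)

/-- **Convergence of the two-level Howard algorithm for discrete Isaacs equations.**
Let `𝒜, ℬ` be nonempty finite sets, `N ≥ 1`.  Assume every problem `F^b(x) = 0` is
solvable and every `F^b` is monotone (`F^b(u) ≤ F^b(v) ⟹ u ≥ v`).  Starting from an
arbitrary `x₋₁` (here `x 0`), choose at each step a componentwise minimizing control
`b_k` (here `b (k+1)`) with `F^{b_k}(x_{k-1}) = F(x_{k-1})` and let `x_k` (here `x (k+1)`)
solve `F^{b_k}(x_k) = 0`.  Then the iterates satisfy `x_k ≥ x_{k+1}` componentwise for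
every `k ≥ 0`, and there exists `k ≤ (#ℬ)^N` with `F(x_k) = 0`. -/
theorem two_level_howard_convergence
    {A B : Type*} [Fintype A] [Nonempty A] [Fintype B] [Nonempty B]
    (N : ℕ) (hN : 1 ≤ N)
    (K : A → B → Matrix (Fin N) (Fin N) ℝ) (f : A → B → Fin N → ℝ)
    (hexist : ∀ b : Fin N → B, ∃ x : Fin N → ℝ, FbOp K f b x = 0)
    (hmono : ∀ (b : Fin N → B) (u v : Fin N → ℝ),
      (∀ i, FbOp K f b u i ≤ FbOp K f b v i) → ∀ i, v i ≤ u i)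
    (x : ℕ → Fin N → ℝ) (b : ℕ → Fin N → B)
    -- `b (k+1)` is a componentwise minimizing selection at `x k`:
    (hsel : ∀ k : ℕ, FbOp K f (b (k+1)) (x k) = FIsaacsOp K f (x k))
    -- `x (k+1)` solves the HJB problem with control `b (k+1)`:
    (hsolve : ∀ k : ℕ, FbOp K f (b (k+1)) (x (k+1)) = 0) :
    (∀ (k : ℕ) (i : Fin N), x (k+2) i ≤ x (k+1) i) ∧
    (∃ k : ℕ, k ≤ (Fintype.card B) ^ N ∧ FIsaacsOp K f (x (k+1)) = 0) := by
  have anti (k : ℕ) (i : Fin N) : x (k+2) i ≤ x (k+1) i := by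
    refine hmono (b (k+2)) _ _ (fun j => ?_) i
    rw [hsel (k+1), hsolve (k+1), ← hsolve k]
    exact FIsaacsOp_le_FbOp K f _ _ j
  refine ⟨anti, ?_⟩
  have hanti : Antitone fun k => x (k+1) := antitone_nat_of_succ_le anti
  have hcard : Fintype.card (Fin N → B) < Fintype.card (Fin (Fintype.card B ^ N + 1)) := by
    simp
  obtain ⟨j, k, hne, hb⟩ := Fintype.exists_ne_map_eq_of_card_lt
    (fun k : Fin (Fintype.card B ^ N + 1) => b (k+1)) hcard
  wlog hjk : j < k generalizing j k
  · exact this k j hne.symm hb.symm (lt_of_le_of_ne (not_lt.mp hjk) hne.symm)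
  have hle : x (j+1) ≤ x (k+1) :=
    hmono (b (k+1)) _ _ fun i => by rw [hsolve k, ← hb, hsolve j]
  have heq : x (j+1) = x (j+2) := le_antisymm (hle.trans (hanti hjk)) (anti j)
  refine ⟨j, Nat.lt_succ_iff.mp j.isLt, ?_⟩
  rw [← hsel (j+1), heq]
  exact hsolve (j+1)
end
end

section
/- Consistency of the discrete Monge–Ampère (Oliker–Prussner) operator on a lattice: let v₁, …, v_d ∈ ℝ^d be linearly independent, let Λ := ℤv₁ + … + ℤv_d be the full-rank lattice they generate, and let M be a real symmetric positive definite d×d matrix. Then the set P := { q ∈ ℝ^d : q · z ≤ (1/2) z · (M z) for all z ∈ Λ } (which is the discrete subdifferential at the origin of the restriction of the quadratic polynomial p(x) = (1/2) x · (M x) to the lattice Λ) is a compact convex set whose d-dimensional Lebesgue measure equals det(M) times the covolume of Λ, i.e. |P| = det(M) · |det(v₁, …, v_d)|. -/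
open scoped BigOperators

noncomputable section

open MeasureTheory Module Submodule

/-- The closed Voronoi cell around the origin of a set `L` in a real inner product space. -/
def voronoiCell {E : Type*} [NormedAddCommGroup E] [InnerProductSpace ℝ E] (L : Set E) : Set E :=
  {y | ∀ z ∈ L, inner ℝ y z ≤ (1 / 2) * ‖z‖ ^ 2}

section VoronoiCell

variable {E : Type*} [NormedAddCommGroup E] [InnerProductSpace ℝ E]

lemma inner_le_half_norm_sq_iff_norm_le (y z : E) :
    inner ℝ y z ≤ (1 / 2) * ‖z‖ ^ 2 ↔ ‖y‖ ≤ ‖y - z‖ := by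
  rw [← sq_le_sq₀ (norm_nonneg _) (norm_nonneg _), norm_sub_sq_real]
  constructor <;> intro h <;> linarith

lemma mem_voronoiCell_iff_norm_le {L : Set E} {y : E} :
    y ∈ voronoiCell L ↔ ∀ z ∈ L, ‖y‖ ≤ ‖y - z‖ :=
  forall₂_congr fun z _ => inner_le_half_norm_sq_iff_norm_le y z

lemma isClosed_voronoiCell (L : Set E) : IsClosed (voronoiCell L) := by
  simp only [voronoiCell, Set.ofPred_forall]
  exact isClosed_biInter fun z _ =>
    isClosed_le (continuous_id.inner continuous_const) continuous_const

lemma convex_voronoiCell (L : Set E) : Convex ℝ (voronoiCell L) := by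
  intro x hx y hy a b ha hb hab z hz
  rw [inner_add_left, real_inner_smul_left, real_inner_smul_left]
  have h₁ := mul_le_mul_of_nonneg_left (hx z hz) ha
  have h₂ := mul_le_mul_of_nonneg_left (hy z hz) hb
  calc _ ≤ (a + b) * ((1 / 2) * ‖z‖ ^ 2) := by linarith
    _ = _ := by rw [hab, one_mul]

variable {ι : Type*} [Fintype ι] (b : Basis ι ℝ E)

lemma isCompact_voronoiCell_span :
    IsCompact (voronoiCell (span ℤ (Set.range b) : Set E)) := by
  have : FiniteDimensional ℝ E := b.finiteDimensional_of_finite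
  have : ProperSpace E := FiniteDimensional.proper_real E
  refine Metric.isCompact_of_isClosed_isBounded (isClosed_voronoiCell _) ?_
  refine isBounded_iff_forall_norm_le.mpr ⟨∑ i, ‖b i‖, fun y hy => ?_⟩
  exact (mem_voronoiCell_iff_norm_le.mp hy _ (ZSpan.floor b y).2).trans (ZSpan.norm_fract_le b y)

lemma exists_vadd_mem_voronoiCell_span (y : E) :
    ∃ g : span ℤ (Set.range b), g +ᵥ y ∈ voronoiCell (span ℤ (Set.range b) : Set E) := by
  have : FiniteDimensional ℝ E := b.finiteDimensional_of_finite
  have : ProperSpace E := FiniteDimensional.proper_real E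
  have hcl : IsClosed (span ℤ (Set.range b) : Set E) :=
    AddSubgroup.isClosed_of_discrete (H := (span ℤ (Set.range b)).toAddSubgroup)
  obtain ⟨g, hg, hgy⟩ := hcl.exists_infDist_eq_dist ⟨0, zero_mem _⟩ y
  refine ⟨-⟨g, hg⟩, mem_voronoiCell_iff_norm_le.mpr fun z hz => ?_⟩
  have h := Metric.infDist_le_dist_of_mem (x := y) (add_mem hg hz)
  rw [hgy, dist_eq_norm, dist_eq_norm] at h
  rw [Submodule.vadd_def, vadd_eq_add, Submodule.coe_neg, neg_add_eq_sub]
  rwa [← sub_sub] at h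

variable [MeasurableSpace E] [BorelSpace E] (μ : Measure E) [μ.IsAddHaarMeasure]

lemma addHaar_setOf_inner_eq [FiniteDimensional ℝ E] {g : E} (hg : g ≠ 0) :
    μ {y | inner ℝ y g = (1 / 2) * ‖g‖ ^ 2} = 0 := by
  have hne : (ℝ ∙ g)ᗮ ≠ ⊤ := by
    rw [Ne, Submodule.orthogonal_eq_top_iff, Submodule.span_singleton_eq_bot]
    exact hg
  have h := μ.addHaar_submodule _ hne
  rw [← measure_preimage_add_right μ (-(1 / 2 : ℝ) • g)] at h
  convert h using 2
  ext y
  rw [Set.mem_preimage, SetLike.mem_coe, Submodule.mem_orthogonal_singleton_iff_inner_left,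
    inner_add_left, real_inner_smul_left, real_inner_self_eq_norm_sq, Set.mem_ofPred_eq]
  constructor <;> intro h <;> linarith

lemma isAddFundamentalDomain_voronoiCell_span :
    IsAddFundamentalDomain (span ℤ (Set.range b))
      (voronoiCell (span ℤ (Set.range b) : Set E)) μ where
  nullMeasurableSet := (isClosed_voronoiCell _).measurableSet.nullMeasurableSet
  ae_covers := .of_forall (exists_vadd_mem_voronoiCell_span b)
  aedisjoint := by
    have : FiniteDimensional ℝ E := b.finiteDimensional_of_finite
    have key : ∀ g : E, g ∈ span ℤ (Set.range b) → ∀ y ∈ voronoiCell (span ℤ (Set.range b) : Set E),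
        y - g ∈ voronoiCell (span ℤ (Set.range b) : Set E) →
        inner ℝ y g = (1 / 2) * ‖g‖ ^ 2 := by
      intro g hg y hy hyg
      have h₁ := hy g hg
      have h₂ := hyg (-g) (neg_mem hg)
      rw [inner_neg_right, inner_sub_left, real_inner_self_eq_norm_sq, norm_neg] at h₂
      linarith
    intro g g' hgg'
    have hne : (g' : E) - g ≠ 0 := sub_ne_zero.mpr fun h => hgg' (Subtype.ext h.symm)
    have h0 := addHaar_setOf_inner_eq μ hne
    rw [← measure_preimage_add_right μ (-(g : E))] at h0
    refine measure_mono_null ?_ h0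
    rintro _ ⟨⟨x, hx, rfl⟩, ⟨x', hx', h⟩⟩
    have h' : (g' : E) + x' = g + x := h
    have hxx' : x' = x - (g' - g) := by
      rw [eq_sub_iff_add_eq, ← add_sub_assoc, sub_eq_iff_eq_add, add_comm x', h', add_comm x]
    have := key _ (sub_mem g'.2 g.2) x hx (hxx' ▸ hx')
    simpa [Submodule.vadd_def] using this

lemma measure_voronoiCell_span :
    μ (voronoiCell (span ℤ (Set.range b) : Set E)) = μ (ZSpan.fundamentalDomain b) := by
  have : FiniteDimensional ℝ E := b.finiteDimensional_of_finite
  have : VAddInvariantMeasure (span ℤ (Set.range b)) E μ :=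
    inferInstanceAs <| VAddInvariantMeasure (span ℤ (Set.range b)).toAddSubgroup E μ
  exact (isAddFundamentalDomain_voronoiCell_span b μ).measure_eq (ZSpan.isAddFundamentalDomain b μ)

end VoronoiCell

/-- **Consistency of the discrete Monge–Ampère (Oliker–Prussner) operator on a lattice.**
Let `v₁, …, v_d ∈ ℝ^d` be linearly independent, generating the full-rank lattice
`Λ = ℤv₁ + … + ℤv_d`, and let `M` be symmetric positive definite.  Then
`P := { q : q·z ≤ ½ z·(Mz) for all z ∈ Λ }` (the discrete subdifferential at the origin of
the restriction of `p(x) = ½ x·(Mx)` to `Λ`) is a compact convex set with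
`|P| = det M · |det(v₁, …, v_d)|`. -/
theorem oliker_prussner_consistency (d : ℕ)
    (v : Fin d → (Fin d → ℝ)) (hv : LinearIndependent ℝ v)
    (M : Matrix (Fin d) (Fin d) ℝ) (hM : M.PosDef) :
    -- the lattice generated by `v₁, …, v_d`:
    let Λ : Set (Fin d → ℝ) := {z | ∃ m : Fin d → ℤ, z = ∑ i, (m i : ℝ) • v i};
    -- the discrete subdifferential of `½ x·Mx` (restricted to `Λ`) at the origin:
    let P : Set (Fin d → ℝ) :=
      {q | ∀ z ∈ Λ, (∑ i, q i * z i) ≤ (1/2) * ∑ i, z i * M.mulVec z i};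
    IsCompact P ∧ Convex ℝ P ∧
      (MeasureTheory.volume P).toReal
        = M.det * |Matrix.det (Matrix.of fun i j => v j i)| := by
  intro Λ P
  obtain ⟨B, hB⟩ : ∃ B : Matrix (Fin d) (Fin d) ℝ, M = B.transpose * B := by
    open scoped MatrixOrder in
    obtain ⟨B, hB⟩ := CStarAlgebra.nonneg_iff_eq_star_mul_self.mp hM.posSemidef.nonneg
    exact ⟨B, by simpa [Matrix.star_eq_conjTranspose] using hB⟩
  have hdet : IsUnit B.det := by
    have := hM.det_pos
    rw [hB, Matrix.det_mul, Matrix.det_transpose] at this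
    exact isUnit_iff_ne_zero.mpr fun h => by simp [h] at this
  have hdetT : IsUnit B.transpose.det := by rwa [Matrix.det_transpose]
  let S : (Fin d → ℝ) ≃ₗ[ℝ] EuclideanSpace ℝ (Fin d) :=
    (B.toLinearEquiv' (B.invertibleOfIsUnitDet hdet)).trans (WithLp.linearEquiv 2 ℝ _).symm
  let T : EuclideanSpace ℝ (Fin d) ≃ₗ[ℝ] (Fin d → ℝ) :=
    (WithLp.linearEquiv 2 ℝ _).trans
      (B.transpose.toLinearEquiv' (B.transpose.invertibleOfIsUnitDet hdetT))
  have hS : ∀ x, (S x).ofLp = B.mulVec x := fun x => rfl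
  have hT : ∀ y, T y = B.transpose.mulVec y.ofLp := fun x => rfl
  have hTS : ∀ x, T (S x) = M.mulVec x := fun x => by
    rw [hT, hS, Matrix.mulVec_mulVec, hB]
  let b₀ : Basis (Fin d) ℝ (Fin d → ℝ) :=
    Basis.mk hv (hv.span_eq_top_of_card_eq_finrank' (by simp)).ge
  have hb₀ : ∀ i, b₀ i = v i := fun i => by simp [b₀]
  let b := b₀.map S
  have hinner : ∀ y z, inner ℝ y (S z) = ∑ i, T y i * z i := fun y z => by
    rw [hT, EuclideanSpace.inner_eq_star_dotProduct, hS, star_trivial, dotProduct_comm,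
      Matrix.dotProduct_mulVec, ← Matrix.mulVec_transpose]
    rfl
  have hnorm : ∀ z, ‖S z‖ ^ 2 = ∑ i, z i * M.mulVec z i := fun z => by
    rw [← real_inner_self_eq_norm_sq, hinner, hTS]
    exact Finset.sum_congr rfl fun i _ => mul_comm _ _
  have hΛ : (span ℤ (Set.range b) : Set (EuclideanSpace ℝ (Fin d))) = S '' Λ := by
    ext x
    have hsum : ∀ m : Fin d → ℤ, ∑ i, m i • b i = S (∑ i, (m i : ℝ) • v i) := fun m => by
      rw [map_sum]
      refine Finset.sum_congr rfl fun i _ => ?_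
      rw [Int.cast_smul_eq_zsmul, map_zsmul, Basis.map_apply, hb₀]
    simp only [SetLike.mem_coe, Submodule.mem_span_range_iff_exists_fun, Λ, Set.mem_image,
      Set.mem_ofPred_eq, hsum]
    constructor
    · rintro ⟨m, rfl⟩
      exact ⟨_, ⟨m, rfl⟩, rfl⟩
    · rintro ⟨_, ⟨m, rfl⟩, rfl⟩
      exact ⟨m, rfl⟩
  have hP : P = T '' voronoiCell (span ℤ (Set.range b) : Set (EuclideanSpace ℝ (Fin d))) := by
    ext q
    obtain ⟨y, rfl⟩ := T.surjective q
    rw [T.injective.mem_set_image, hΛ]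
    simp only [P, voronoiCell, Set.mem_ofPred_eq, Set.forall_mem_image, hinner, hnorm]
  refine ⟨?_, ?_, ?_⟩
  · rw [hP]
    exact (isCompact_voronoiCell_span b).image T.toContinuousLinearEquiv.continuous
  · rw [hP]
    exact (convex_voronoiCell _).linear_image T.toLinearMap
  · let T' := T.symm.toContinuousLinearEquiv
    let μ : Measure (EuclideanSpace ℝ (Fin d)) := volume.map T'
    have : μ.IsAddHaarMeasure := T'.isAddHaarMeasure_map volume
    have hμ : ∀ s, μ s = volume (T '' s) := fun s => by
      refine (T'.toHomeomorph.toMeasurableEquiv.map_apply s).trans ?_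
      exact congrArg volume (T.toEquiv.image_eq_preimage_symm s).symm
    have hmat : Matrix.of (b.map T) = (M * Matrix.of fun i j => v j i).transpose := by
      ext i j
      simp [b, hb₀, hTS, Matrix.mul_apply, Matrix.mulVec, dotProduct]
    rw [hP, ← hμ, measure_voronoiCell_span b μ, hμ, ZSpan.map_fundamentalDomain,
      ZSpan.volume_fundamentalDomain, ENNReal.toReal_ofReal (abs_nonneg _), hmat,
      Matrix.det_transpose, Matrix.det_mul, abs_mul, abs_of_pos hM.det_pos]
end
end

section
/- Stability of discrete Monge–Ampère subdifferential measures: there exists C > 0 depending only on d such that the following holds. In the envelope setting, assume additionally that every interior node lies in the interior of the convex hull of Ω̄_h (so discrete subdifferentials at interior nodes are compact). Let v, w : Ω̄_h → ℝ be nodal functions with v ≥ w on Ω_h^B and with w a convex nodal function (∂w(z) ≠ ∅ for every z ∈ Ω_h^I). Then |∂v(z)| ≥ |∂w(z)| for every z ∈ 𝒞_h⁻(v−w), and sup_{z∈Ω̄_h} (v − w)⁻(z) ≤ C · R · ( Σ_{z ∈ 𝒞_h⁻(v−w)} ( |∂v(z)|^{1/d} − |∂w(z)|^{1/d} )^d )^{1/d},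 where ∂v, ∂w are the discrete subdifferentials with respect to Ω̄_h and 𝒞_h⁻(v−w) is the contact set of the nodal function v − w. -/
open scoped BigOperators Classical

noncomputable section

/-- The discrete (nodal) subdifferential
`∂v(z) = {p : v(x) ≥ v(z) + p·(x - z) for all nodes x ∈ Ω̄_h}`. -/
def nodalSubdiff {d : ℕ} (Ωh : Finset (EuclideanSpace ℝ (Fin d)))
    (v : EuclideanSpace ℝ (Fin d) → ℝ) (z : EuclideanSpace ℝ (Fin d)) :
    Set (EuclideanSpace ℝ (Fin d)) :=
  {p | ∀ x ∈ Ωh, v z + ∑ i, p i * (x i - z i) ≤ v x}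

section DiscreteMongeAmpere

open MeasureTheory Set
open scoped Pointwise ENNReal

theorem volume_add_volume_le_of_isCompact {K L : Set ℝ} (hK : IsCompact K) (hL : IsCompact L)
    (hK0 : K.Nonempty) (hL0 : L.Nonempty) : volume K + volume L ≤ volume (K + L) := by
  have hmax := hK.sSup_mem hK0
  have hmin := hL.sInf_mem hL0
  set a := sSup K
  set b := sInf L
  have h1 : volume (K + {b}) = volume K := by
    rw [add_singleton]; simp [measure_preimage_add_right]
  have h2 : volume ({a} + L) = volume L := by
    rw [singleton_add]; simp [measure_preimage_add]
  have hmeas : MeasurableSet ({a} + L) := (isCompact_singleton.add hL).measurableSet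
  have hinter : volume ((K + {b}) ∩ ({a} + L)) = 0 := by
    refine measure_mono_null (t := {a + b}) ?_ (by simp)
    rintro x ⟨⟨k, hk, _, rfl, rfl⟩, ⟨_, rfl, l, hl, hx⟩⟩
    have : k ≤ a := le_csSup hK.bddAbove hk
    have : b ≤ l := csInf_le hL.bddBelow hl
    simp only [mem_singleton_iff] at *
    linarith
  rw [← h1, ← h2, ← measure_union_add_inter _ hmeas, hinter, add_zero]
  refine measure_mono (union_subset ?_ ?_)
  · exact add_subset_add_left (singleton_subset_iff.2 hmin)
  · exact add_subset_add_right (singleton_subset_iff.2 hmax)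

theorem measure_le_of_add_subset {E : Type*} [AddCommGroup E] [MeasurableSpace E]
    [MeasurableAdd E] {μ : Measure E} [μ.IsAddLeftInvariant] {S T U : Set E} (hT0 : T.Nonempty)
    (h : S + T ⊆ U) : μ S ≤ μ U := by
  obtain ⟨t, ht⟩ := hT0
  rw [← measure_preimage_add μ (-t) S]
  refine measure_mono fun x hx => h ⟨-t + x, hx, t, ht, by simp⟩

/-- The one-dimensional Brunn-Minkowski inequality for measurable sets. -/
theorem volume_add_volume_le_of_add_subset {S T U : Set ℝ} (hS : MeasurableSet S)
    (hT : MeasurableSet T) (hS0 : S.Nonempty) (hT0 : T.Nonempty) (h : S + T ⊆ U) :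
    volume S + volume T ≤ volume U := by
  rcases eq_or_ne (volume S) 0 with hS' | hS'
  · rw [hS', zero_add]
    exact measure_le_of_add_subset hS0 (add_comm S T ▸ h)
  rcases eq_or_ne (volume T) 0 with hT' | hT'
  · rw [hT', add_zero]
    exact measure_le_of_add_subset hT0 h
  refine le_of_forall_lt fun c hc => ?_
  obtain ⟨a, ha, b, hb, hab⟩ := ENNReal.exists_lt_add_of_lt_add hc hS' hT'
  obtain ⟨K, hKS, hK, haK⟩ := hS.exists_lt_isCompact ha
  obtain ⟨L, hLT, hL, hbL⟩ := hT.exists_lt_isCompact hb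
  have hK0 : K.Nonempty := nonempty_of_measure_ne_zero (pos_of_gt haK).ne'
  have hL0 : L.Nonempty := nonempty_of_measure_ne_zero (pos_of_gt hbL).ne'
  calc c < volume K + volume L := hab.trans (ENNReal.add_lt_add haK hbL)
    _ ≤ volume (K + L) := volume_add_volume_le_of_isCompact hK hL hK0 hL0
    _ ≤ volume U := measure_mono ((add_subset_add hKS hLT).trans h)

/-- A one-dimensional Prékopa-Leindler type inequality for functions with supremum `1`. -/
theorem lintegral_add_lintegral_le_of_min_le {f g k : ℝ → ℝ} (hf : Measurable f)
    (hg : Measurable g) (hk : Measurable k) (hf0 : 0 ≤ f) (hg0 : 0 ≤ g) (hk0 : 0 ≤ k)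
    (hf1 : f ≤ 1) (hg1 : g ≤ 1) (hfs : ∀ r < 1, ∃ x, r < f x) (hgs : ∀ r < 1, ∃ x, r < g x)
    {s t : ℝ} (hs : 0 < s) (ht : 0 < t) (h : ∀ x y, min (f x) (g y) ≤ k (s * x + t * y)) :
    ENNReal.ofReal s * (∫⁻ x, ENNReal.ofReal (f x)) +
      ENNReal.ofReal t * (∫⁻ x, ENNReal.ofReal (g x))
      ≤ ∫⁻ x, ENNReal.ofReal (k x) := by
  have meas (f : ℝ → ℝ) : Measurable fun r : ℝ => volume {x | r < f x} :=
    Antitone.measurable fun a b hab => measure_mono fun x hx => lt_of_le_of_lt hab hx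
  rw [lintegral_eq_lintegral_meas_lt volume (.of_forall hf0) hf.aemeasurable,
    lintegral_eq_lintegral_meas_lt volume (.of_forall hg0) hg.aemeasurable,
    lintegral_eq_lintegral_meas_lt volume (.of_forall hk0) hk.aemeasurable,
    ← lintegral_const_mul _ (meas f), ← lintegral_const_mul _ (meas g),
    ← lintegral_add_left ((meas f).const_mul _)]
  refine lintegral_mono fun r => ?_
  rcases le_or_gt 1 r with hr | hr
  · have h1 : {x | r < f x} = ∅ := eq_empty_of_forall_notMem fun x hx =>
      absurd (hf1 x) (not_le.2 (lt_of_le_of_lt hr hx))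
    have h2 : {x | r < g x} = ∅ := eq_empty_of_forall_notMem fun x hx =>
      absurd (hg1 x) (not_le.2 (lt_of_le_of_lt hr hx))
    simp [h1, h2]
  · have key (S : Set ℝ) {a : ℝ} (ha : 0 < a) :
        ENNReal.ofReal a * volume S = volume (a • S) := by
      simp [Measure.addHaar_smul, abs_of_pos ha]
    rw [key _ hs, key _ ht]
    refine volume_add_volume_le_of_add_subset
      ((measurableSet_lt measurable_const hf).const_smul₀ s)
      ((measurableSet_lt measurable_const hg).const_smul₀ t)
      (Set.Nonempty.smul_set (hfs r hr)) (Set.Nonempty.smul_set (hgs r hr)) ?_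
    rintro _ ⟨_, ⟨x, hx, rfl⟩, _, ⟨y, hy, rfl⟩, rfl⟩
    exact lt_of_lt_of_le (lt_min hx hy) (h x y)

/-- The slice of a subset of `ℝⁿ⁺¹` over a fixed first coordinate. -/
def firstCoordSlice {n : ℕ} (A : Set (Fin (n + 1) → ℝ)) (x : ℝ) : Set (Fin n → ℝ) :=
  {y | Fin.cons x y ∈ A}

theorem IsCompact.firstCoordSlice {n : ℕ} {A : Set (Fin (n + 1) → ℝ)} (hA : IsCompact A) (x : ℝ) :
    IsCompact (firstCoordSlice A x) := by
  have hc : Continuous fun y : Fin n → ℝ => (Fin.cons x y : Fin (n + 1) → ℝ) := by fun_prop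
  refine (hA.image (f := fun z => Fin.tail z) (by unfold Fin.tail; fun_prop)).of_isClosed_subset
    (hA.isClosed.preimage hc) ?_
  intro y hy
  exact ⟨_, hy, Fin.tail_cons _ _⟩

theorem bddAbove_volume_firstCoordSlice {n : ℕ} {A : Set (Fin (n + 1) → ℝ)} (hA : IsCompact A) :
    BddAbove (range fun x => volume.real (firstCoordSlice A x)) := by
  have hT : IsCompact ((fun z => Fin.tail z) '' A) :=
    hA.image (f := fun z => Fin.tail z) (by unfold Fin.tail; fun_prop)
  refine ⟨volume.real ((fun z => Fin.tail z) '' A), ?_⟩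
  rintro _ ⟨x, rfl⟩
  exact measureReal_mono (fun y hy => ⟨_, hy, Fin.tail_cons _ _⟩) hT.measure_lt_top.ne

theorem firstCoordSlice_eq_preimage {n : ℕ} (A : Set (Fin (n + 1) → ℝ)) (x : ℝ) :
    firstCoordSlice A x =
      Prod.mk x ⁻¹' ((MeasurableEquiv.piFinSuccAbove (fun _ => ℝ) 0).symm ⁻¹' A) := by
  ext y
  simp [firstCoordSlice, MeasurableEquiv.piFinSuccAbove, Fin.insertNthEquiv, Fin.insertNth_zero']

theorem measurable_volume_firstCoordSlice {n : ℕ} {A : Set (Fin (n + 1) → ℝ)}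
    (hA : MeasurableSet A) : Measurable fun x => volume (firstCoordSlice A x) := by
  have h := (MeasurableEquiv.piFinSuccAbove (fun _ : Fin (n + 1) => ℝ) 0).symm.measurable hA
  convert! measurable_measure_prodMk_left (ν := (volume : Measure (Fin n → ℝ))) h using 2 with x
  exact congrArg volume (firstCoordSlice_eq_preimage A x)

theorem lintegral_volume_firstCoordSlice {n : ℕ} {A : Set (Fin (n + 1) → ℝ)}
    (hA : MeasurableSet A) : ∫⁻ x, volume (firstCoordSlice A x) = volume A := by
  have h := (volume_preserving_piFinSuccAbove (fun _ : Fin (n + 1) => ℝ) 0).symm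
  rw [← h.measure_preimage_equiv, Measure.volume_eq_prod, Measure.prod_apply (h.measurable hA)]
  simp_rw [firstCoordSlice_eq_preimage]

theorem firstCoordSlice_add_subset {n : ℕ} (A B : Set (Fin (n + 1) → ℝ)) (s t x y : ℝ) :
    s • firstCoordSlice A x + t • firstCoordSlice B y ⊆
      firstCoordSlice (s • A + t • B) (s * x + t * y) := by
  rintro _ ⟨_, ⟨a, ha, rfl⟩, _, ⟨b, hb, rfl⟩, rfl⟩
  refine ⟨_, ⟨_, ha, rfl⟩, _, ⟨_, hb, rfl⟩, ?_⟩
  ext i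
  refine Fin.cases ?_ (fun i => ?_) i <;> simp

/-- The multiplicative form of the Brunn-Minkowski inequality for compact sets. -/
theorem volume_rpow_mul_volume_rpow_le {n : ℕ} : ∀ {A B : Set (Fin n → ℝ)}, IsCompact A →
    IsCompact B → ∀ {s t : ℝ}, 0 < s → 0 < t → s + t = 1 →
    volume.real A ^ s * volume.real B ^ t ≤ volume.real (s • A + t • B) := by
  induction n with
  | zero =>
    intro A B hA hB s t hs ht hst
    rcases A.eq_empty_or_nonempty with rfl | hA0
    · simp [Real.zero_rpow hs.ne']
    rcases B.eq_empty_or_nonempty with rfl | hB0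
    · simp [Real.zero_rpow ht.ne']
    have key {S : Set (Fin 0 → ℝ)} (h : S.Nonempty) : volume.real S = 1 := by
      rw [Subsingleton.eq_univ_of_nonempty h]
      simp [measureReal_def, volume_pi]
    rw [key hA0, key hB0, key (hA0.smul_set.add hB0.smul_set)]
    simp
  | succ n ih =>
    intro A B hA hB s t hs ht hst
    have hC : IsCompact (s • A + t • B) := (hA.smul s).add (hB.smul t)
    set C := s • A + t • B with hCdef
    have hint {S : Set (Fin (n + 1) → ℝ)} (hS : IsCompact S) :
        ∫⁻ x, ENNReal.ofReal (volume.real (firstCoordSlice S x)) = volume S := by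
      rw [← lintegral_volume_firstCoordSlice hS.measurableSet]
      refine lintegral_congr fun x => ?_
      exact ENNReal.ofReal_toReal (hS.firstCoordSlice x).measure_lt_top.ne
    have hmeas {S : Set (Fin (n + 1) → ℝ)} (hS : IsCompact S) :
        Measurable fun x => volume.real (firstCoordSlice S x) :=
      (measurable_volume_firstCoordSlice hS.measurableSet).ennreal_toReal
    rcases eq_or_ne (volume.real A) 0 with hA0 | hA0
    · simp [hA0, Real.zero_rpow hs.ne']
    rcases eq_or_ne (volume.real B) 0 with hB0 | hB0
    · simp [hB0, Real.zero_rpow ht.ne']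
    have hsup {S : Set (Fin (n + 1) → ℝ)} (hS : IsCompact S) (hS0 : volume.real S ≠ 0) :
        0 < ⨆ x, volume.real (firstCoordSlice S x) := by
      by_contra! hle
      apply hS0
      rw [measureReal_def, ← hint hS]
      have (x : ℝ) : volume.real (firstCoordSlice S x) ≤ 0 :=
        (le_ciSup (bddAbove_volume_firstCoordSlice hS) x).trans hle
      simp [ENNReal.ofReal_of_nonpos (this _)]
    have ha := hsup hA hA0
    have hb := hsup hB hB0
    have haA := le_ciSup (bddAbove_volume_firstCoordSlice hA)
    have hbB := le_ciSup (bddAbove_volume_firstCoordSlice hB)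
    have haA' := fun r => exists_lt_of_lt_ciSup (b := r)
      (f := fun x => volume.real (firstCoordSlice A x))
    have hbB' := fun r => exists_lt_of_lt_ciSup (b := r)
      (f := fun x => volume.real (firstCoordSlice B x))
    set a := ⨆ x, volume.real (firstCoordSlice A x)
    set b := ⨆ x, volume.real (firstCoordSlice B x)
    set c := a ^ s * b ^ t with hc
    have hc0 : 0 < c := by positivity
    have main := lintegral_add_lintegral_le_of_min_le
      (f := fun x => volume.real (firstCoordSlice A x) / a)
      (g := fun x => volume.real (firstCoordSlice B x) / b)
      (k := fun x => volume.real (firstCoordSlice C x) / c)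
      ((hmeas hA).div_const a) ((hmeas hB).div_const b) ((hmeas hC).div_const c)
      (fun x => by positivity) (fun x => by positivity) (fun x => by positivity)
      (fun x => (div_le_one ha).2 (haA x)) (fun x => (div_le_one hb).2 (hbB x))
      (fun r hr => ?_) (fun r hr => ?_) hs ht (fun x y => ?_)
    · have hdiv {S : Set (Fin (n + 1) → ℝ)} (hS : IsCompact S) {q : ℝ} (hq : 0 < q) :
          ∫⁻ x, ENNReal.ofReal (volume.real (firstCoordSlice S x) / q)
            = ENNReal.ofReal (volume.real S / q) := by
        simp_rw [div_eq_mul_inv, ENNReal.ofReal_mul measureReal_nonneg]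
        rw [lintegral_mul_const _ (hmeas hS).ennreal_ofReal, hint hS, measureReal_def,
          ENNReal.ofReal_toReal hS.measure_lt_top.ne]
      rw [hdiv hA ha, hdiv hB hb, hdiv hC hc0, ← ENNReal.ofReal_mul hs.le,
        ← ENNReal.ofReal_mul ht.le, ← ENNReal.ofReal_add (by positivity) (by positivity),
        ENNReal.ofReal_le_ofReal_iff (by positivity), le_div_iff₀ hc0] at main
      refine le_trans ?_ main
      have amgm := Real.geom_mean_le_arith_mean2_weighted hs.le ht.le
        (p₁ := volume.real A / a) (p₂ := volume.real B / b) (by positivity) (by positivity) hst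
      calc _ = ((volume.real A / a) ^ s * (volume.real B / b) ^ t) * c := by
            rw [Real.div_rpow (by positivity) ha.le, Real.div_rpow (by positivity) hb.le, hc]
            field_simp
        _ ≤ _ := by gcongr
    · obtain ⟨x, hx⟩ := haA' (r * a) (by nlinarith)
      exact ⟨x, (lt_div_iff₀ ha).2 hx⟩
    · obtain ⟨x, hx⟩ := hbB' (r * b) (by nlinarith)
      exact ⟨x, (lt_div_iff₀ hb).2 hx⟩
    · rw [le_div_iff₀ hc0]
      refine le_trans ?_ ((ih (hA.firstCoordSlice x) (hB.firstCoordSlice y) hs ht hst).trans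
        (measureReal_mono (firstCoordSlice_add_subset A B s t x y)
          (hC.firstCoordSlice _).measure_lt_top.ne))
      set p := volume.real (firstCoordSlice A x)
      set q := volume.real (firstCoordSlice B y)
      have hp : 0 ≤ p := measureReal_nonneg
      have hq : 0 ≤ q := measureReal_nonneg
      set m := min (p / a) (q / b)
      have hm : 0 ≤ m := le_min (by positivity) (by positivity)
      have hma : m * a ≤ p := (le_div_iff₀ ha).1 (min_le_left _ _)
      have hmb : m * b ≤ q := (le_div_iff₀ hb).1 (min_le_right _ _)
      calc m * c = (m * a) ^ s * (m * b) ^ t := by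
            rw [Real.mul_rpow hm ha.le, Real.mul_rpow hm hb.le, hc,
              mul_mul_mul_comm, ← Real.rpow_add_of_nonneg hm hs.le ht.le, hst, Real.rpow_one]
        _ ≤ _ := by gcongr

theorem brunn_minkowski_pi {n : ℕ} (hn : n ≠ 0) {A B : Set (Fin n → ℝ)} (hA : IsCompact A)
    (hB : IsCompact B) (hA0 : A.Nonempty) (hB0 : B.Nonempty) :
    volume.real A ^ ((1 : ℝ) / n) + volume.real B ^ ((1 : ℝ) / n)
      ≤ volume.real (A + B) ^ ((1 : ℝ) / n) := by
  have hn' : (0 : ℝ) < n := by positivity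
  have hAB : IsCompact (A + B) := hA.add hB
  have mono {S : Set (Fin n → ℝ)} (h : volume S ≤ volume (A + B)) :
      volume.real S ^ ((1 : ℝ) / n) ≤ volume.real (A + B) ^ ((1 : ℝ) / n) :=
    Real.rpow_le_rpow measureReal_nonneg
      (ENNReal.toReal_mono hAB.measure_lt_top.ne h) (by positivity)
  have hzero : (0 : ℝ) ^ ((1 : ℝ) / n) = 0 := Real.zero_rpow (by positivity)
  rcases eq_or_ne (volume.real A) 0 with hA1 | hA1
  · rw [hA1, hzero, zero_add]
    exact mono (measure_le_of_add_subset hA0 (add_comm B A).subset)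
  rcases eq_or_ne (volume.real B) 0 with hB1 | hB1
  · rw [hB1, hzero, add_zero]
    exact mono (measure_le_of_add_subset hB0 subset_rfl)
  have hA2 : 0 < volume.real A := lt_of_le_of_ne measureReal_nonneg hA1.symm
  have hB2 : 0 < volume.real B := lt_of_le_of_ne measureReal_nonneg hB1.symm
  set a := volume.real A ^ ((1 : ℝ) / n) with ha
  set b := volume.real B ^ ((1 : ℝ) / n) with hb
  have ha0 : 0 < a := by positivity
  have hb0 : 0 < b := by positivity
  have hpow {x : ℝ} (hx : 0 ≤ x) : (x ^ ((1 : ℝ) / n)) ^ n = x := by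
    rw [one_div, Real.rpow_inv_natCast_pow hx hn]
  have hscale (S : Set (Fin n → ℝ)) {r : ℝ} (hr : 0 < r) :
      volume.real (r • S) = r ^ n * volume.real S := by
    rw [measureReal_def, Measure.addHaar_smul, ENNReal.toReal_mul,
      ENNReal.toReal_ofReal (by positivity)]
    simp [abs_of_pos hr, measureReal_def]
  have key := volume_rpow_mul_volume_rpow_le (hA.smul ((a + b) / a)) (hB.smul ((a + b) / b))
    (s := a / (a + b)) (t := b / (a + b)) (by positivity) (by positivity) (by field_simp)
  rw [smul_smul, smul_smul, hscale A (by positivity), hscale B (by positivity),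
    show a / (a + b) * ((a + b) / a) = 1 by field_simp,
    show b / (a + b) * ((a + b) / b) = 1 by field_simp, one_smul, one_smul,
    ← hpow hA2.le, ← hpow hB2.le, ← ha, ← hb, ← mul_pow, ← mul_pow,
    div_mul_cancel₀ _ ha0.ne', div_mul_cancel₀ _ hb0.ne',
    ← Real.rpow_add (by positivity), ← add_div, div_self (by positivity), Real.rpow_one] at key
  calc a + b = ((a + b) ^ n) ^ ((1 : ℝ) / n) := by
        rw [one_div, Real.pow_rpow_inv_natCast (by positivity) hn]
    _ ≤ _ := by gcongr

/-- The Brunn-Minkowski inequality for nonempty compact subsets of Euclidean space. -/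
theorem brunn_minkowski {n : ℕ} (hn : n ≠ 0) {A B : Set (EuclideanSpace ℝ (Fin n))}
    (hA : IsCompact A) (hB : IsCompact B) (hA0 : A.Nonempty) (hB0 : B.Nonempty) :
    volume.real A ^ ((1 : ℝ) / n) + volume.real B ^ ((1 : ℝ) / n)
      ≤ volume.real (A + B) ^ ((1 : ℝ) / n) := by
  let e := EuclideanSpace.equiv (Fin n) ℝ
  have he (S : Set (EuclideanSpace ℝ (Fin n))) : volume.real S = volume.real (e '' S) := by
    have h := (PiLp.volume_preserving_toLp (Fin n)).measure_preimage_equiv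
      (f := MeasurableEquiv.toLp 2 (Fin n → ℝ)) S
    rw [measureReal_def, measureReal_def, ← h]
    congr 2
    exact (e.toEquiv.image_eq_preimage_symm S).symm
  rw [he, he, he, image_add]
  exact brunn_minkowski_pi hn (hA.image e.continuous) (hB.image e.continuous) (hA0.image e)
    (hB0.image e)

/-- The slopes at `z` of the affine functions touching the extension of `-u⁻` from below at `z`. -/
def envSlopes {d : ℕ} (h R : ℝ) (Ω : Finset (EuclideanSpace ℝ (Fin d)))
    (u : EuclideanSpace ℝ (Fin d) → ℝ) (z : EuclideanSpace ℝ (Fin d)) :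
    Set (EuclideanSpace ℝ (Fin d)) :=
  {p | ∀ ζ : EuclideanSpace ℝ (Fin d), IsLatticePt h ζ → ‖ζ‖ < R →
    u z + ∑ i, p i * (ζ i - z i) ≤ extNeg Ω u ζ}

theorem extNeg_le_zero {d : ℕ} (Ω : Finset (EuclideanSpace ℝ (Fin d)))
    (u : EuclideanSpace ℝ (Fin d) → ℝ) (ζ : EuclideanSpace ℝ (Fin d)) : extNeg Ω u ζ ≤ 0 := by
  unfold extNeg nPart
  split_ifs <;> simp

theorem extNeg_le_of_mem {d : ℕ} {Ω : Finset (EuclideanSpace ℝ (Fin d))}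
    {u : EuclideanSpace ℝ (Fin d) → ℝ} {ζ : EuclideanSpace ℝ (Fin d)} (hζ : ζ ∈ Ω) :
    extNeg Ω u ζ ≤ u ζ := by
  rw [extNeg, if_pos hζ, nPart, neg_le]
  exact le_max_left _ _

theorem sum_mul_sub_eq_inner {d : ℕ} (p x z : EuclideanSpace ℝ (Fin d)) :
    ∑ i, p i * (x i - z i) = inner ℝ p (x - z) := by
  simp [PiLp.inner_apply, mul_comm]

theorem continuous_sum_mul_sub {d : ℕ} (x z : EuclideanSpace ℝ (Fin d)) :
    Continuous fun p : EuclideanSpace ℝ (Fin d) => ∑ i, p i * (x i - z i) := by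
  fun_prop

theorem exists_norm_mul_le_of_mem_interior_convexHull {d : ℕ}
    {T : Set (EuclideanSpace ℝ (Fin d))} {z : EuclideanSpace ℝ (Fin d)}
    (hz : z ∈ interior (convexHull ℝ T)) :
    ∃ ρ > 0, ∀ (p : EuclideanSpace ℝ (Fin d)) (M : ℝ),
      (∀ x ∈ T, ∑ i, p i * (x i - z i) ≤ M) → ‖p‖ * ρ ≤ M := by
  obtain ⟨ρ, hρ, hball⟩ := Metric.nhds_basis_closedBall.mem_iff.1 (mem_interior_iff_mem_nhds.1 hz)
  refine ⟨ρ, hρ, fun p M hM => ?_⟩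
  have hconv : Convex ℝ {x : EuclideanSpace ℝ (Fin d) | inner ℝ p x ≤ M + inner ℝ p z} :=
    convex_halfSpace_le (innerₛₗ ℝ p).isLinear _
  have hsub : convexHull ℝ T ⊆ {x | inner ℝ p x ≤ M + inner ℝ p z} := by
    refine convexHull_min (fun x hx => ?_) hconv
    have := hM x hx
    rw [sum_mul_sub_eq_inner, inner_sub_right] at this
    rw [mem_ofPred_eq]
    linarith
  rcases eq_or_ne p 0 with rfl | hp
  · have := hsub (hball (Metric.mem_closedBall_self hρ.le))
    simp_all
  have hp' : 0 < ‖p‖ := norm_pos_iff.2 hp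
  have hmem : z + (ρ / ‖p‖) • p ∈ Metric.closedBall z ρ := by
    simp [norm_smul, abs_of_pos hρ, hp'.ne']
  have := hsub (hball hmem)
  rw [mem_ofPred_eq, inner_add_right, inner_smul_right, real_inner_self_eq_norm_sq] at this
  have h2 : ρ / ‖p‖ * ‖p‖ ^ 2 = ‖p‖ * ρ := by field_simp
  linarith

theorem isCompact_nodalSubdiff {d : ℕ} {Ω : Finset (EuclideanSpace ℝ (Fin d))}
    {z : EuclideanSpace ℝ (Fin d)} (hz : z ∈ interior (convexHull ℝ (Ω : Set _)))
    (v : EuclideanSpace ℝ (Fin d) → ℝ) : IsCompact (nodalSubdiff Ω v z) := by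
  obtain ⟨ρ, hρ, H⟩ := exists_norm_mul_le_of_mem_interior_convexHull hz
  refine Metric.isCompact_of_isClosed_isBounded ?_ ?_
  · simp only [nodalSubdiff, ofPred_forall]
    exact isClosed_biInter fun x _ =>
      isClosed_le (continuous_const.add (continuous_sum_mul_sub x z)) continuous_const
  · obtain ⟨M, hM⟩ := (Ω.image v).bddAbove
    refine (Metric.isBounded_closedBall (x := 0) (r := (M - v z) / ρ)).subset fun p hp => ?_
    rw [mem_closedBall_zero_iff, le_div_iff₀ hρ]
    refine H p _ fun x hx => ?_
    have h1 := hp x hx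
    have h2 := hM (Finset.mem_coe.2 (Finset.mem_image_of_mem v hx))
    linarith

theorem isClosed_envSlopes {d : ℕ} (h R : ℝ) (Ω : Finset (EuclideanSpace ℝ (Fin d)))
    (u : EuclideanSpace ℝ (Fin d) → ℝ) (z : EuclideanSpace ℝ (Fin d)) :
    IsClosed (envSlopes h R Ω u z) := by
  simp only [envSlopes, ofPred_forall]
  exact isClosed_iInter fun x => isClosed_iInter fun _ => isClosed_iInter fun _ =>
    isClosed_le (continuous_const.add (continuous_sum_mul_sub x z)) continuous_const

theorem envSlopes_subset_nodalSubdiff {d : ℕ} {h R : ℝ} {Ω : Finset (EuclideanSpace ℝ (Fin d))}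
    (hΩ : ∀ z ∈ Ω, IsLatticePt h z ∧ ‖z‖ < R) (u : EuclideanSpace ℝ (Fin d) → ℝ)
    (z : EuclideanSpace ℝ (Fin d)) : envSlopes h R Ω u z ⊆ nodalSubdiff Ω u z :=
  fun _ hp x hx => (hp x (hΩ x hx).1 (hΩ x hx).2).trans (extNeg_le_of_mem hx)

theorem nodalSubdiff_add_subset {d : ℕ} (Ω : Finset (EuclideanSpace ℝ (Fin d)))
    (u w : EuclideanSpace ℝ (Fin d) → ℝ) (z : EuclideanSpace ℝ (Fin d)) :
    nodalSubdiff Ω u z + nodalSubdiff Ω w z ⊆ nodalSubdiff Ω (fun x => u x + w x) z := by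
  rintro _ ⟨p, hp, q, hq, rfl⟩ x hx
  have h1 := hp x hx
  have h2 := hq x hx
  simp only [PiLp.add_apply, add_mul, Finset.sum_add_distrib]
  linarith

theorem exists_le_extNeg {d : ℕ} (Ω : Finset (EuclideanSpace ℝ (Fin d)))
    (u : EuclideanSpace ℝ (Fin d) → ℝ) : ∃ c, ∀ ζ, c ≤ extNeg Ω u ζ := by
  obtain ⟨c, hc⟩ := (Ω.image (extNeg Ω u)).bddBelow
  refine ⟨min c 0, fun ζ => ?_⟩
  by_cases hζ : ζ ∈ Ω
  · exact (min_le_left _ _).trans (hc (Finset.mem_coe.2 (Finset.mem_image_of_mem _ hζ)))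
  · rw [extNeg, if_neg hζ]
    exact min_le_right _ _

theorem discEnv_set_bddAbove {d : ℕ} {h R : ℝ} (Ω : Finset (EuclideanSpace ℝ (Fin d)))
    (u : EuclideanSpace ℝ (Fin d) → ℝ) {z : EuclideanSpace ℝ (Fin d)} (hz : IsLatticePt h z)
    (hzR : ‖z‖ < R) :
    extNeg Ω u z ∈ upperBounds {t : ℝ | ∃ (p : EuclideanSpace ℝ (Fin d)) (c : ℝ),
      (∀ ζ : EuclideanSpace ℝ (Fin d), IsLatticePt h ζ → ‖ζ‖ < R →
        (∑ i, p i * ζ i) + c ≤ extNeg Ω u ζ) ∧ t = (∑ i, p i * z i) + c} := by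
  rintro _ ⟨p, c, hp, rfl⟩
  exact hp z hz hzR

theorem discEnv_eq_of_mem_envSlopes {d : ℕ} {h R : ℝ} {Ω : Finset (EuclideanSpace ℝ (Fin d))}
    {u : EuclideanSpace ℝ (Fin d) → ℝ} {z : EuclideanSpace ℝ (Fin d)} (hz : IsLatticePt h z)
    (hzR : ‖z‖ < R) (hu : extNeg Ω u z ≤ u z) {p : EuclideanSpace ℝ (Fin d)}
    (hp : p ∈ envSlopes h R Ω u z) : discEnv h R Ω u z = u z := by
  have hmem : u z ∈ {t : ℝ | ∃ (p : EuclideanSpace ℝ (Fin d)) (c : ℝ),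
      (∀ ζ : EuclideanSpace ℝ (Fin d), IsLatticePt h ζ → ‖ζ‖ < R →
        (∑ i, p i * ζ i) + c ≤ extNeg Ω u ζ) ∧ t = (∑ i, p i * z i) + c} := by
    refine ⟨p, u z - ∑ i, p i * z i, fun ζ h1 h2 => ?_, by ring⟩
    have := hp ζ h1 h2
    simp only [mul_sub, Finset.sum_sub_distrib] at this
    linarith
  have hub := discEnv_set_bddAbove Ω u hz hzR
  exact le_antisymm ((csSup_le ⟨_, hmem⟩ hub).trans hu) (le_csSup ⟨_, hub⟩ hmem)

theorem envSlopes_nonempty {d : ℕ} {h R : ℝ} {Ω : Finset (EuclideanSpace ℝ (Fin d))}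
    (hΩ : ∀ z ∈ Ω, IsLatticePt h z ∧ ‖z‖ < R) {u : EuclideanSpace ℝ (Fin d) → ℝ}
    {z : EuclideanSpace ℝ (Fin d)} (hzΩ : z ∈ Ω)
    (hz : z ∈ interior (convexHull ℝ (Ω : Set _))) (henv : discEnv h R Ω u z = u z) :
    (envSlopes h R Ω u z).Nonempty := by
  obtain ⟨ρ, hρ, H⟩ := exists_norm_mul_le_of_mem_interior_convexHull hz
  let K : Set (EuclideanSpace ℝ (Fin d) × ℝ) := {q | q.2 ∈ Icc (u z - 1) 0 ∧
    ∀ ζ : EuclideanSpace ℝ (Fin d), IsLatticePt h ζ → ‖ζ‖ < R →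
      q.2 + ∑ i, q.1 i * (ζ i - z i) ≤ extNeg Ω u ζ}
  have hKc : IsCompact K := by
    refine ((isCompact_closedBall (0 : EuclideanSpace ℝ (Fin d)) ((1 - u z) / ρ)).prod
      (isCompact_Icc (a := u z - 1) (b := 0))).of_isClosed_subset ?_ ?_
    · simp only [K, ofPred_and, ofPred_forall]
      refine (isClosed_Icc.preimage continuous_snd).inter ?_
      exact isClosed_iInter fun x => isClosed_iInter fun _ => isClosed_iInter fun _ =>
        isClosed_le (continuous_snd.add ((continuous_sum_mul_sub x z).comp continuous_fst))
          continuous_const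
    · rintro ⟨p, t⟩ ⟨ht, hp⟩
      refine ⟨?_, ht⟩
      rw [mem_closedBall_zero_iff, le_div_iff₀ hρ]
      refine H p _ fun x hx => ?_
      have h1 := hp x (hΩ x hx).1 (hΩ x hx).2
      have h2 := extNeg_le_zero Ω u x
      have h3 := ht.1
      simp only at h1 h3
      linarith
  obtain ⟨hzl, hzR⟩ := hΩ z hzΩ
  have hub := discEnv_set_bddAbove Ω u hzl hzR
  have approx : ∀ r < u z, u z - 1 ≤ r → ∃ q ∈ K, r < q.2 := by
    intro r hr hr1
    rw [← henv, discEnv] at hr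
    obtain ⟨c, hc⟩ := exists_le_extNeg Ω u
    obtain ⟨_, ⟨p, c, hp, rfl⟩, hlt⟩ := exists_lt_of_lt_csSup
      (by exact ⟨c, 0, c, fun ζ _ _ => by simpa using hc ζ, by simp⟩) hr
    refine ⟨(p, (∑ i, p i * z i) + c), ⟨⟨hr1.trans hlt.le, ?_⟩, fun ζ h1 h2 => ?_⟩, hlt⟩
    · exact (hp z hzl hzR).trans (extNeg_le_zero _ _ _)
    · have := hp ζ h1 h2
      simp only [mul_sub, Finset.sum_sub_distrib]
      linarith
  obtain ⟨q₀, hq₀, -⟩ := approx (u z - 1) (by linarith) le_rfl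
  obtain ⟨⟨p, t⟩, hq, hmax⟩ := hKc.exists_isMaxOn ⟨q₀, hq₀⟩ continuous_snd.continuousOn
  have ht : u z ≤ t := by
    by_contra! hlt
    obtain ⟨q, hqK, hlt'⟩ := approx t hlt hq.1.1
    exact absurd (hmax hqK) (not_le.2 hlt')
  refine ⟨p, fun ζ h1 h2 => ?_⟩
  have := hq.2 ζ h1 h2
  simp only at this
  linarith

theorem exists_mem_envSlopes_of_norm_lt {d : ℕ} {h R : ℝ} (hR : 0 < R)
    {ΩI ΩB : Finset (EuclideanSpace ℝ (Fin d))}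
    (hΩ : ∀ z ∈ ΩI ∪ ΩB, IsLatticePt h z ∧ ‖z‖ < R) {u : EuclideanSpace ℝ (Fin d) → ℝ}
    (hB : ∀ z ∈ ΩB, 0 ≤ u z) {z₀ : EuclideanSpace ℝ (Fin d)} (hz₀ : z₀ ∈ ΩI ∪ ΩB)
    {p : EuclideanSpace ℝ (Fin d)} (hp : ‖p‖ < nPart (u z₀) / (2 * R)) :
    ∃ z ∈ contactSet h R ΩI (ΩI ∪ ΩB) u, p ∈ envSlopes h R (ΩI ∪ ΩB) u z := by
  set Ω := ΩI ∪ ΩB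
  obtain ⟨z, hzΩ, hmin⟩ := Ω.exists_min_image (fun x => extNeg Ω u x - inner ℝ p x) ⟨z₀, hz₀⟩
  have hfar (ζ : EuclideanSpace ℝ (Fin d)) (hζ : ‖ζ‖ < R) :
      extNeg Ω u z - inner ℝ p z < - inner ℝ p ζ := by
    refine (hmin z₀ hz₀).trans_lt ?_
    rw [extNeg, if_pos hz₀]
    have h1 : inner ℝ p ζ - inner ℝ p z₀ ≤ ‖p‖ * ‖ζ - z₀‖ := by
      rw [← inner_sub_right]
      exact real_inner_le_norm _ _
    have h2 : ‖ζ - z₀‖ ≤ 2 * R := by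
      have := norm_sub_le ζ z₀
      have := (hΩ z₀ hz₀).2
      linarith
    have h3 : ‖p‖ * ‖ζ - z₀‖ ≤ ‖p‖ * (2 * R) := by gcongr
    have h4 := (lt_div_iff₀ (by positivity)).1 hp
    linarith
  obtain ⟨hzl, hzR⟩ := hΩ z hzΩ
  have hneg : extNeg Ω u z < 0 := by linarith [hfar z hzR]
  have huz : extNeg Ω u z = u z ∧ u z < 0 := by
    rw [extNeg, if_pos hzΩ, nPart] at hneg ⊢
    rcases max_cases (-u z) 0 with hm | hm <;> constructor <;> linarith [hm.1, hm.2]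
  have hzI : z ∈ ΩI := (Finset.mem_union.1 hzΩ).resolve_right fun hz =>
    absurd (hB z hz) (not_le.2 huz.2)
  have hslope : p ∈ envSlopes h R Ω u z := by
    intro ζ h1 h2
    rw [sum_mul_sub_eq_inner, inner_sub_right, ← huz.1]
    by_cases hζ : ζ ∈ Ω
    · have := hmin ζ hζ
      linarith
    · rw [show extNeg Ω u ζ = 0 by rw [extNeg, if_neg hζ]]
      linarith [hfar ζ h2]
  exact ⟨z, Finset.mem_filter.2 ⟨hzI, discEnv_eq_of_mem_envSlopes hzl hzR huz.1.le hslope⟩, hslope⟩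

theorem nPart_pow_mul_volume_ball_le {d : ℕ} (hd : d ≠ 0) {h R : ℝ} (hR : 0 < R)
    {ΩI ΩB : Finset (EuclideanSpace ℝ (Fin d))}
    (hΩ : ∀ z ∈ ΩI ∪ ΩB, IsLatticePt h z ∧ ‖z‖ < R)
    (hint : ∀ z ∈ ΩI, z ∈ interior (convexHull ℝ (↑(ΩI ∪ ΩB) : Set (EuclideanSpace ℝ (Fin d)))))
    {u : EuclideanSpace ℝ (Fin d) → ℝ}
    (hB : ∀ z ∈ ΩB, 0 ≤ u z) {z₀ : EuclideanSpace ℝ (Fin d)} (hz₀ : z₀ ∈ ΩI ∪ ΩB) :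
    (nPart (u z₀) / (2 * R)) ^ d * volume.real (Metric.ball (0 : EuclideanSpace ℝ (Fin d)) 1) ≤
      ∑ z ∈ contactSet h R ΩI (ΩI ∪ ΩB) u, volume.real (envSlopes h R (ΩI ∪ ΩB) u z) := by
  set r := nPart (u z₀) / (2 * R)
  have hr : 0 ≤ r := div_nonneg (le_max_right _ _) (by positivity)
  have hfin : ∀ z ∈ contactSet h R ΩI (ΩI ∪ ΩB) u,
      volume (envSlopes h R (ΩI ∪ ΩB) u z) ≠ ⊤ := fun z hz =>
    ((measure_mono (envSlopes_subset_nodalSubdiff hΩ u z)).trans_lt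
      (isCompact_nodalSubdiff (hint z (Finset.mem_filter.1 hz).1) u).measure_lt_top).ne
  have hball : volume (Metric.ball (0 : EuclideanSpace ℝ (Fin d)) r) ≤
      ∑ z ∈ contactSet h R ΩI (ΩI ∪ ΩB) u, volume (envSlopes h R (ΩI ∪ ΩB) u z) := by
    refine (measure_mono fun p hp => ?_).trans (measure_biUnion_finset_le _ _)
    obtain ⟨z, hz, hpz⟩ :=
      exists_mem_envSlopes_of_norm_lt hR hΩ hB hz₀ (mem_ball_zero_iff.1 hp)
    exact mem_biUnion (Finset.mem_coe.2 hz) hpz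
  have := ENNReal.toReal_mono (ENNReal.sum_ne_top.2 hfin) hball
  rw [ENNReal.toReal_sum hfin] at this
  refine le_trans (le_of_eq ?_) this
  rcases hr.eq_or_lt with h0 | h0
  · simp [← h0, hd]
  · rw [Measure.addHaar_ball_of_pos _ _ h0, ENNReal.toReal_mul,
      ENNReal.toReal_ofReal (by positivity)]
    simp [measureReal_def]

theorem rpow_add_rpow_le_of_mem_contactSet {d : ℕ} (hd : 0 < d) {h R : ℝ}
    {ΩI ΩB : Finset (EuclideanSpace ℝ (Fin d))}
    (hΩ : ∀ z ∈ ΩI ∪ ΩB, IsLatticePt h z ∧ ‖z‖ < R)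
    (hint : ∀ z ∈ ΩI, z ∈ interior (convexHull ℝ (↑(ΩI ∪ ΩB) : Set (EuclideanSpace ℝ (Fin d)))))
    {v w : EuclideanSpace ℝ (Fin d) → ℝ}
    (hw : ∀ z ∈ ΩI, (nodalSubdiff (ΩI ∪ ΩB) w z).Nonempty) {z : EuclideanSpace ℝ (Fin d)}
    (hz : z ∈ contactSet h R ΩI (ΩI ∪ ΩB) (fun x => v x - w x)) :
    volume (nodalSubdiff (ΩI ∪ ΩB) w z) ≤ volume (nodalSubdiff (ΩI ∪ ΩB) v z) ∧
    volume.real (envSlopes h R (ΩI ∪ ΩB) (fun x => v x - w x) z) ^ ((1 : ℝ) / d) +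
      volume.real (nodalSubdiff (ΩI ∪ ΩB) w z) ^ ((1 : ℝ) / d) ≤
      volume.real (nodalSubdiff (ΩI ∪ ΩB) v z) ^ ((1 : ℝ) / d) := by
  obtain ⟨hzI, henv⟩ := Finset.mem_filter.1 hz
  have hzint := hint z hzI
  have hne := envSlopes_nonempty hΩ (Finset.mem_union_left _ hzI) hzint henv
  have hsub := envSlopes_subset_nodalSubdiff hΩ (fun x => v x - w x) z
  have hcomp := (isCompact_nodalSubdiff hzint (fun x => v x - w x)).of_isClosed_subset
    (isClosed_envSlopes h R _ _ z) hsub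
  have hadd : envSlopes h R (ΩI ∪ ΩB) (fun x => v x - w x) z + nodalSubdiff (ΩI ∪ ΩB) w z ⊆
      nodalSubdiff (ΩI ∪ ΩB) v z := by
    refine (add_subset_add_right hsub).trans ((nodalSubdiff_add_subset _ _ _ _).trans_eq ?_)
    simp
  refine ⟨measure_le_of_add_subset hne ((add_comm _ _).trans_subset hadd), ?_⟩
  refine (brunn_minkowski hd.ne' hcomp (isCompact_nodalSubdiff hzint w) hne (hw z hzI)).trans ?_
  exact Real.rpow_le_rpow measureReal_nonneg
    (measureReal_mono hadd (isCompact_nodalSubdiff hzint v).measure_lt_top.ne) (by positivity)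

end DiscreteMongeAmpere

/-- **Stability of discrete Monge–Ampère subdifferential measures.**  There is `C > 0`
depending only on `d` such that, for nodes `Ω̄_h = Ω_h^I ∪ Ω_h^B ⊆ hℤ^d ∩ B_R(0)` whose
interior nodes lie in the interior of `conv(Ω̄_h)`, and nodal functions `v ≥ w` on `Ω_h^B`
with `w` a convex nodal function:  `|∂v(z)| ≥ |∂w(z)|` at each contact point `z` of
`v - w`, and
`sup (v-w)⁻ ≤ C R (∑_{z ∈ 𝒞_h⁻(v-w)} (|∂v(z)|^{1/d} - |∂w(z)|^{1/d})^d)^{1/d}`. -/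
theorem discrete_monge_ampere_stability (d : ℕ) (hd : 0 < d) :
    ∃ C : ℝ, 0 < C ∧
      ∀ (h R : ℝ), 0 < h → 0 < R →
      ∀ ΩI ΩB : Finset (EuclideanSpace ℝ (Fin d)),
        Disjoint ΩI ΩB →
        (∀ z ∈ ΩI ∪ ΩB, IsLatticePt h z ∧ ‖z‖ < R) →
        -- every interior node lies in the interior of the convex hull of the node set:
        (∀ z ∈ ΩI, z ∈ interior (convexHull ℝ (↑(ΩI ∪ ΩB) : Set (EuclideanSpace ℝ (Fin d))))) →
      ∀ v w : EuclideanSpace ℝ (Fin d) → ℝ,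
        (∀ z ∈ ΩB, w z ≤ v z) →
        -- `w` is a convex nodal function:
        (∀ z ∈ ΩI, (nodalSubdiff (ΩI ∪ ΩB) w z).Nonempty) →
        (∀ z ∈ contactSet h R ΩI (ΩI ∪ ΩB) (fun x => v x - w x),
            MeasureTheory.volume (nodalSubdiff (ΩI ∪ ΩB) w z)
              ≤ MeasureTheory.volume (nodalSubdiff (ΩI ∪ ΩB) v z)) ∧
        (∀ z ∈ ΩI ∪ ΩB,
          nPart (v z - w z) ≤ C * R *
            (∑ z' ∈ contactSet h R ΩI (ΩI ∪ ΩB) (fun x => v x - w x),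
              ((MeasureTheory.volume (nodalSubdiff (ΩI ∪ ΩB) v z')).toReal ^ ((1:ℝ)/d)
                - (MeasureTheory.volume (nodalSubdiff (ΩI ∪ ΩB) w z')).toReal ^ ((1:ℝ)/d)) ^ d)
            ^ ((1:ℝ)/d)) := by
  have hd0 : d ≠ 0 := hd.ne'
  set ω := MeasureTheory.volume.real (Metric.ball (0 : EuclideanSpace ℝ (Fin d)) 1) with hω
  have hω0 : 0 < ω := ENNReal.toReal_pos (Metric.measure_ball_pos _ _ one_pos).ne'
    MeasureTheory.measure_ball_lt_top.ne
  refine ⟨2 / ω ^ ((1 : ℝ) / d), by positivity, ?_⟩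
  intro h R _ hR ΩI ΩB _ hΩ hint v w hB hw
  have key := fun z hz => rpow_add_rpow_le_of_mem_contactSet hd hΩ hint (v := v) hw (z := z) hz
  refine ⟨fun z hz => (key z hz).1, fun z hz => ?_⟩
  have hle := nPart_pow_mul_volume_ball_le hd0 hR hΩ hint (u := fun x => v x - w x)
    (fun x hx => sub_nonneg.2 (hB x hx)) hz
  have hsum := hle.trans (Finset.sum_le_sum fun x hx => show _ ≤
      ((MeasureTheory.volume (nodalSubdiff (ΩI ∪ ΩB) v x)).toReal ^ ((1:ℝ)/d)
        - (MeasureTheory.volume (nodalSubdiff (ΩI ∪ ΩB) w x)).toReal ^ ((1:ℝ)/d)) ^ d by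
    have hpow := Real.rpow_inv_natCast_pow (n := d) (x := MeasureTheory.volume.real
      (envSlopes h R (ΩI ∪ ΩB) (fun x => v x - w x) x)) MeasureTheory.measureReal_nonneg hd0
    rw [← hpow, ← one_div]
    exact pow_le_pow_left₀ (by positivity) (le_sub_iff_add_le.2 (key x hx).2) d)
  set N := nPart (v z - w z)
  have hN : 0 ≤ N := le_max_right _ _
  have hroot := Real.rpow_le_rpow (by positivity) hsum (z := (1 : ℝ) / d) (by positivity)
  rw [Real.mul_rpow (by positivity) hω0.le, one_div, Real.pow_rpow_inv_natCast (by positivity) hd0,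
    ← one_div] at hroot
  calc N = 2 / ω ^ ((1 : ℝ) / d) * R * (N / (2 * R) * ω ^ ((1 : ℝ) / d)) := by
        field_simp
    _ ≤ _ := by gcongr
end
end
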